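/- Let H be a complex Hilbert space and let A = C + T, where C is a non-negative compact operator on H such that lim_{n→∞} n^2 s_n(C) = ∞ and lim_{n→∞} n^α s_n(C) = a for some constants 0 < α < 2 and 0 < a < ∞, and T is a compact operator belonging to the Schatten–von Neumann class S_q for some 0 < q ≤ 1/α. Then the adjoint operator A* cannot be a Volterra operator; that is, A* has at least one nonzero eigenvalue. -/

import Mathlib

open Filter Topology

/-- The `n`-th singular value (`s`-number) of an operator on a Hilbert space,
indexed so that `sNum T 1 = ‖T‖` is the first singular value: `sNum T n` is the
distance from `T` to the operators of rank `< n`.  For compact operators this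
coincides with the usual sequence of eigenvalues of `|T| = (T^*T)^{1/2}`
arranged in non-increasing order, counted with multiplicity. -/
noncomputable def sNum {H : Type*} [NormedAddCommGroup H] [InnerProductSpace ℂ H]
    (T : H →L[ℂ] H) (n : ℕ) : ℝ :=
  ⨅ F : {F : H →L[ℂ] H // Module.rank ℂ (LinearMap.range (F : H →ₗ[ℂ] H)) < (n : Cardinal)},
    ‖T - (F : H →L[ℂ] H)‖

namespace SV
universe u
section basics
variable {E : Type u} [NormedAddCommGroup E] [InnerProductSpace ℂ E]
variable {E' : Type u} [NormedAddCommGroup E'] [InnerProductSpace ℂ E']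

theorem card_aux {c d e : Cardinal.{u}} {p q k : ℕ} (hc : c < p) (hd : d < q) (he : e ≤ c + d)
    (h : p + q ≤ k + 1) : e < k := by
  obtain ⟨a, rfl⟩ := Cardinal.lt_aleph0.1 (hc.trans (Cardinal.natCast_lt_aleph0))
  obtain ⟨b, rfl⟩ := Cardinal.lt_aleph0.1 (hd.trans (Cardinal.natCast_lt_aleph0))
  have h1 : a < p := by exact_mod_cast hc
  have h2 : b < q := by exact_mod_cast hd
  refine he.trans_lt ?_
  have : a + b < k := by omega
  exact_mod_cast this

theorem sNum_nonneg (T : E →L[ℂ] E) (n : ℕ) : 0 ≤ sNum T n :=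
  Real.iInf_nonneg fun _ => norm_nonneg _

theorem sNum_le (T F : E →L[ℂ] E) {n : ℕ} (h : LinearMap.rank (F : E →ₗ[ℂ] E) < n) :
    sNum T n ≤ ‖T - F‖ := by
  have hb : BddBelow (Set.range fun F : {F : E →L[ℂ] E //
      Module.rank ℂ (LinearMap.range (F : E →ₗ[ℂ] E)) < (n : Cardinal)} => ‖T - (F : E →L[ℂ] E)‖) :=
    ⟨0, by rintro _ ⟨F, rfl⟩; exact norm_nonneg _⟩
  exact ciInf_le hb ⟨F, h⟩

theorem rank_zero_lt {n : ℕ} (hn : 1 ≤ n) :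
    LinearMap.rank ((0 : E →L[ℂ] E) : E →ₗ[ℂ] E) < n := by
  rw [ContinuousLinearMap.toLinearMap_zero, LinearMap.rank_zero]
  exact_mod_cast hn

theorem nonempty_aux {n : ℕ} (hn : 1 ≤ n) : Nonempty {F : E →L[ℂ] E //
      Module.rank ℂ (LinearMap.range (F : E →ₗ[ℂ] E)) < (n : Cardinal)} :=
  ⟨⟨0, rank_zero_lt hn⟩⟩

theorem le_sNum (T : E →L[ℂ] E) {n : ℕ} (hn : 1 ≤ n) {x : ℝ}
    (h : ∀ F : E →L[ℂ] E, LinearMap.rank (F : E →ₗ[ℂ] E) < n → x ≤ ‖T - F‖) : x ≤ sNum T n := by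
  haveI := nonempty_aux (E := E) hn
  exact le_ciInf fun F => h F.1 F.2

theorem exists_lt (T : E →L[ℂ] E) {n : ℕ} (hn : 1 ≤ n) {x : ℝ} (hx : sNum T n < x) :
    ∃ F : E →L[ℂ] E, LinearMap.rank (F : E →ₗ[ℂ] E) < n ∧ ‖T - F‖ < x := by
  by_contra! h
  exact absurd (le_sNum T hn h) (not_le.2 hx)

theorem sNum_antitone (T : E →L[ℂ] E) {m n : ℕ} (hm : 1 ≤ m) (h : m ≤ n) : sNum T n ≤ sNum T m :=
  le_sNum T hm fun F hF => sNum_le T F (hF.trans_le (by exact_mod_cast h))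

theorem sNum_le_norm (T : E →L[ℂ] E) {n : ℕ} (hn : 1 ≤ n) : sNum T n ≤ ‖T‖ := by
  simpa using sNum_le T 0 (rank_zero_lt hn)

theorem sNum_le_add_norm (X Y : E →L[ℂ] E) {n : ℕ} (hn : 1 ≤ n) :
    sNum X n ≤ sNum Y n + ‖X - Y‖ := by
  rw [← sub_le_iff_le_add]
  refine le_sNum Y hn fun F hF => ?_
  have := sNum_le X F hF
  have h2 : ‖X - F‖ ≤ ‖X - Y‖ + ‖Y - F‖ := by
    have := norm_add_le (X - Y) (Y - F); simpa using this
  linarith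

theorem sNum_one_add_le (Y : E →L[ℂ] E) {n : ℕ} (hn : 1 ≤ n) : sNum (1 + Y) n ≤ 1 + sNum Y n := by
  have := sNum_le_add_norm (1 + Y) Y hn
  have h1 : ‖(1 : E →L[ℂ] E)‖ ≤ 1 := ContinuousLinearMap.norm_id_le
  simp only [add_sub_cancel_right] at this
  linarith

theorem sNum_comp3 (B : E' →L[ℂ] E') (X : E' →L[ℂ] E) (Y : E →L[ℂ] E') {n : ℕ} (hn : 1 ≤ n) :
    sNum (X ∘L B ∘L Y) n ≤ ‖X‖ * sNum B n * ‖Y‖ := by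
  have key : ∀ x, sNum B n < x → sNum (X ∘L B ∘L Y) n ≤ ‖X‖ * x * ‖Y‖ := by
    intro x hx
    obtain ⟨F, hF, hFx⟩ := exists_lt B hn hx
    have hr : LinearMap.rank ((X ∘L F ∘L Y : E →L[ℂ] E) : E →ₗ[ℂ] E) < n := by
      refine lt_of_le_of_lt ?_ hF
      exact (LinearMap.rank_comp_le_right ((F : E' →ₗ[ℂ] E').comp (Y : E →ₗ[ℂ] E')) (X : E' →ₗ[ℂ] E)).trans
        (LinearMap.rank_comp_le_left (Y : E →ₗ[ℂ] E') (F : E' →ₗ[ℂ] E'))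
    refine (sNum_le _ _ hr).trans ?_
    have : X ∘L B ∘L Y - X ∘L F ∘L Y = X ∘L (B - F) ∘L Y := by ext v; simp
    rw [this]
    calc _ ≤ ‖X‖ * (‖B - F‖ * ‖Y‖) := (ContinuousLinearMap.opNorm_comp_le _ _).trans
          (by gcongr; exact ContinuousLinearMap.opNorm_comp_le _ _)
      _ ≤ ‖X‖ * (x * ‖Y‖) := by gcongr
      _ = _ := by ring
  have ht : Tendsto (fun x => ‖X‖ * x * ‖Y‖) (𝓝[>] (sNum B n)) (𝓝 (‖X‖ * sNum B n * ‖Y‖)) :=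
    (Continuous.tendsto (by fun_prop) _).mono_left nhdsWithin_le_nhds
  exact ge_of_tendsto ht (by filter_upwards [self_mem_nhdsWithin] with x hx using key x hx)

theorem sNum_mul_left_le (R B : E →L[ℂ] E) {n : ℕ} (hn : 1 ≤ n) :
    sNum (R * B) n ≤ ‖R‖ * sNum B n := by
  have h := sNum_comp3 B R (ContinuousLinearMap.id ℂ E) hn
  have h1 : ‖ContinuousLinearMap.id ℂ E‖ ≤ 1 := ContinuousLinearMap.norm_id_le
  refine (h.trans ?_)
  exact mul_le_of_le_one_right (mul_nonneg (norm_nonneg _) (sNum_nonneg _ _)) h1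

theorem sNum_smul_le (c : ℂ) (B : E →L[ℂ] E) {n : ℕ} (hn : 1 ≤ n) :
    sNum (c • B) n ≤ ‖c‖ * sNum B n := by
  have h := sNum_mul_left_le (c • (1 : E →L[ℂ] E)) B hn
  rw [smul_mul_assoc, one_mul] at h
  refine h.trans ?_
  refine mul_le_mul_of_nonneg_right ?_ (sNum_nonneg _ _)
  rw [norm_smul]
  exact mul_le_of_le_one_right (norm_nonneg _) ContinuousLinearMap.norm_id_le

theorem sNum_add_le (X Y : E →L[ℂ] E) {p q k : ℕ} (hp : 1 ≤ p) (hq : 1 ≤ q) (h : p + q ≤ k + 1) :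
    sNum (X + Y) k ≤ sNum X p + sNum Y q := by
  refine le_of_forall_pos_le_add fun ε hε => ?_
  obtain ⟨F, hF, hFx⟩ := exists_lt X hp (x := sNum X p + ε / 2) (by linarith)
  obtain ⟨G, hG, hGx⟩ := exists_lt Y hq (x := sNum Y q + ε / 2) (by linarith)
  have := sNum_le (X + Y) (F + G) (n := k)
    (card_aux hF hG (LinearMap.rank_add_le (F : E →ₗ[ℂ] E) (G : E →ₗ[ℂ] E)) h)
  have h2 : X + Y - (F + G) = (X - F) + (Y - G) := by abel
  rw [h2] at this
  have := norm_add_le (X - F) (Y - G)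
  linarith

theorem sNum_mul_le (X Y : E →L[ℂ] E) {p q k : ℕ} (hp : 1 ≤ p) (hq : 1 ≤ q) (h : p + q ≤ k + 1) :
    sNum (X * Y) k ≤ sNum X p * sNum Y q := by
  have key : ∀ ε > 0, sNum (X * Y) k ≤ (sNum X p + ε) * (sNum Y q + ε) := by
    intro ε hε
    obtain ⟨F, hF, hFx⟩ := exists_lt X hp (x := sNum X p + ε) (by linarith)
    obtain ⟨G, hG, hGx⟩ := exists_lt Y hq (x := sNum Y q + ε) (by linarith)
    have hr : LinearMap.rank ((F * Y + (X - F) * G : E →L[ℂ] E) : E →ₗ[ℂ] E) < k := by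
      refine card_aux hF hG ((LinearMap.rank_add_le ((F * Y : E →L[ℂ] E) : E →ₗ[ℂ] E)
        (((X - F) * G : E →L[ℂ] E) : E →ₗ[ℂ] E)).trans ?_) h
      gcongr
      · exact LinearMap.rank_comp_le_left (Y : E →ₗ[ℂ] E) (F : E →ₗ[ℂ] E)
      · exact LinearMap.rank_comp_le_right (G : E →ₗ[ℂ] E) ((X - F : E →L[ℂ] E) : E →ₗ[ℂ] E)
    have := sNum_le (X * Y) _ hr
    have h2 : X * Y - (F * Y + (X - F) * G) = (X - F) * (Y - G) := by noncomm_ring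
    rw [h2] at this
    refine this.trans ((norm_mul_le _ _).trans ?_)
    have := sNum_nonneg X p
    gcongr
  have ht : Tendsto (fun ε => (sNum X p + ε) * (sNum Y q + ε)) (𝓝[>] 0)
      (𝓝 ((sNum X p + 0) * (sNum Y q + 0))) :=
    (Continuous.tendsto (by fun_prop) _).mono_left nhdsWithin_le_nhds
  simp only [add_zero] at ht
  exact ge_of_tendsto ht (by filter_upwards [self_mem_nhdsWithin] with x hx using key x hx)

end basics
end SV

namespace SV
set_option linter.unusedSectionVars false
theorem le_of_sq_le_sq {a b : ℝ} (h : a ^ 2 ≤ b ^ 2) (hb : 0 ≤ b) : a ≤ b := (le_abs_self a).trans (abs_le_of_sq_le_sq h hb)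
universe u
section findim
open Module
variable {V : Type u} [NormedAddCommGroup V] [InnerProductSpace ℂ V] [FiniteDimensional ℂ V]

theorem norm_sq_sum {n : ℕ} (b : OrthonormalBasis (Fin n) ℂ V) (g : Fin n → ℂ) :
    ‖∑ i, g i • b i‖ ^ 2 = ∑ i, ‖g i‖ ^ 2 := by
  rw [← OrthonormalBasis.sum_sq_norm_inner_right b]
  refine Finset.sum_congr rfl fun i _ => ?_
  rw [b.orthonormal.inner_right_fintype]

theorem exists_sv (X : V →L[ℂ] V) : ∃ (b : OrthonormalBasis (Fin (finrank ℂ V)) ℂ V)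
    (σ : Fin (finrank ℂ V) → ℝ), (∀ i, 0 ≤ σ i) ∧ Antitone σ ∧
    (∀ g : Fin (finrank ℂ V) → ℂ, ‖X (∑ i, g i • b i)‖ ^ 2 = ∑ i, σ i ^ 2 * ‖g i‖ ^ 2) ∧
    ‖X.det‖ = ∏ i, σ i := by
  set L : V →ₗ[ℂ] V := (X : V →ₗ[ℂ] V) with hL
  have hp : (LinearMap.adjoint L ∘ₗ L).IsPositive := LinearMap.isPositive_adjoint_comp_self L
  have hs := hp.isSymmetric
  let b := hs.eigenvectorBasis rfl
  let μ := hs.eigenvalues rfl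
  have hμ : ∀ i, 0 ≤ μ i := fun i => hp.nonneg_eigenvalues rfl i
  have hμa : Antitone μ := hs.eigenvalues_antitone rfl
  refine ⟨b, fun i => √(μ i), fun i => Real.sqrt_nonneg _, fun i j hij => Real.sqrt_le_sqrt (hμa hij),
    ?_, ?_⟩
  · intro g
    have h1 : (LinearMap.adjoint L ∘ₗ L) (∑ i, g i • b i) = ∑ i, (g i * (μ i : ℂ)) • b i := by
      rw [map_sum]
      refine Finset.sum_congr rfl fun i _ => ?_
      rw [map_smul, hs.apply_eigenvectorBasis rfl i, smul_smul]; rfl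
    have h2 : (‖X (∑ i, g i • b i)‖ ^ 2 : ℂ) = inner ℂ (∑ i, g i • b i) ((LinearMap.adjoint L ∘ₗ L) (∑ i, g i • b i)) := by
      rw [LinearMap.comp_apply, LinearMap.adjoint_inner_right, inner_self_eq_norm_sq_to_K]
      rfl
    rw [h1, b.orthonormal.inner_sum] at h2
    have h3 : (∑ i, (starRingEnd ℂ) (g i) * (g i * (μ i : ℂ))) = ((∑ i, √(μ i) ^ 2 * ‖g i‖ ^ 2 : ℝ) : ℂ) := by
      push_cast
      refine Finset.sum_congr rfl fun i _ => ?_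
      rw [← mul_assoc, Complex.conj_mul', mul_comm]
      congr 1
      rw [← Complex.ofReal_pow, Real.sq_sqrt (hμ i)]
    rw [h3] at h2
    exact_mod_cast h2
  · have hd : LinearMap.det (LinearMap.adjoint L ∘ₗ L) = ∏ i, (μ i : ℂ) :=
      hs.det_eq_prod_eigenvalues rfl
    have hadj : LinearMap.det (LinearMap.adjoint L) = star (LinearMap.det L) := by
      rw [← LinearMap.det_toMatrix b.toBasis, ← LinearMap.det_toMatrix b.toBasis,
        LinearMap.toMatrix_adjoint, Matrix.det_conjTranspose]
    rw [LinearMap.det_comp, hadj] at hd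
    have h1 : (‖X.det‖ ^ 2 : ℝ) = ∏ i, μ i := by
      have : star (LinearMap.det L) * LinearMap.det L = ((‖LinearMap.det L‖ ^ 2 : ℝ) : ℂ) := by
        have := Complex.conj_mul' (LinearMap.det L)
        push_cast; exact this
      rw [this] at hd
      exact_mod_cast hd
    have h2 : (∏ i, √(μ i)) ^ 2 = ∏ i, μ i := by
      rw [← Finset.prod_pow]
      exact Finset.prod_congr rfl fun i _ => Real.sq_sqrt (hμ i)
    exact (pow_left_inj₀ (norm_nonneg _) (Finset.prod_nonneg fun i _ => Real.sqrt_nonneg _)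
      two_ne_zero).1 (h1.trans h2.symm)

theorem sv_le_sNum (X : V →L[ℂ] V) (b : OrthonormalBasis (Fin (finrank ℂ V)) ℂ V)
    (σ : Fin (finrank ℂ V) → ℝ) (h0 : ∀ i, 0 ≤ σ i) (ha : Antitone σ)
    (hX : ∀ g : Fin (finrank ℂ V) → ℂ, ‖X (∑ i, g i • b i)‖ ^ 2 = ∑ i, σ i ^ 2 * ‖g i‖ ^ 2)
    (j : Fin (finrank ℂ V)) : σ j ≤ sNum X (j + 1) := by
  refine le_sNum X (by omega) fun F hF => ?_
  have hdep : ¬ LinearIndependent ℂ (fun i : {i : Fin (finrank ℂ V) // i ≤ j} =>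
      (⟨F (b i), ⟨b i, rfl⟩⟩ : LinearMap.range (F : V →ₗ[ℂ] V))) := by
    intro hli
    have h1 := hli.cardinal_lift_le_rank
    have hc : Cardinal.mk {i : Fin (finrank ℂ V) // i ≤ j} = ((j : ℕ) + 1 : ℕ) := by
      rw [Cardinal.mk_fintype, Fintype.card_subtype]
      have : Finset.univ.filter (fun i : Fin (finrank ℂ V) => i ≤ j) = Finset.Iic j := by ext; simp
      rw [this, Fin.card_Iic]
    rw [hc, Cardinal.lift_natCast] at h1
    have h2 : Cardinal.lift.{0} (Module.rank ℂ (LinearMap.range (F : V →ₗ[ℂ] V))) < ((j : ℕ) + 1 : ℕ) := by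
      rw [Cardinal.lift_id']; exact hF
    exact absurd h1 (not_le.2 h2)
  rw [Fintype.not_linearIndependent_iff] at hdep
  obtain ⟨g, hg, ⟨i0, hi0⟩⟩ := hdep
  let g' : Fin (finrank ℂ V) → ℂ := fun i => if h : i ≤ j then g ⟨i, h⟩ else 0
  let v := ∑ i, g' i • b i
  have hg'0 : ∀ i, ¬ i ≤ j → g' i = 0 := fun i hi => by simp [g', hi]
  have hFv : F v = 0 := by
    have h1 : F v = ∑ i, g' i • F (b i) := by simp [v]
    have h2 := congrArg Subtype.val hg
    simp only [AddSubmonoidClass.coe_finsetSum, Submodule.coe_smul, ZeroMemClass.coe_zero] at h2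
    rw [h1, ← h2, ← Finset.sum_subset (Finset.subset_univ (Finset.Iic j))]
    · rw [Finset.sum_subtype (p := fun i => i ≤ j) (Finset.Iic j) (by simp)]
      refine Finset.sum_congr rfl fun i _ => ?_
      simp [g', i.2]
    · intro i _ hi
      rw [hg'0 i (by simpa using hi), zero_smul]
  have hv : 0 < ‖v‖ ^ 2 := by
    rw [norm_sq_sum]
    have : 0 < ‖g' i0‖ ^ 2 := by
      have : g' i0 = g i0 := by simp [g', i0.2]
      rw [this]; positivity
    exact this.trans_le (Finset.single_le_sum (f := fun i => ‖g' i‖ ^ 2) (fun i _ => by positivity) (Finset.mem_univ _))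
  have h1 : σ j ^ 2 * ‖v‖ ^ 2 ≤ ‖X v‖ ^ 2 := by
    rw [hX, norm_sq_sum, Finset.mul_sum]
    refine Finset.sum_le_sum fun i _ => ?_
    by_cases hi : i ≤ j
    · have := ha hi
      have := h0 j
      gcongr
    · simp [hg'0 i hi]
  have h2 : ‖X v‖ ≤ ‖X - F‖ * ‖v‖ := by
    have := (X - F).le_opNorm v
    simpa [hFv] using this
  have h3 : σ j * ‖v‖ ≤ ‖X v‖ := by
    rw [← mul_pow] at h1
    exact le_of_sq_le_sq h1 (norm_nonneg _)
  have h4 : 0 < ‖v‖ := by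
    rcases (norm_nonneg v).lt_or_eq with h | h
    · exact h
    · rw [← h] at hv; simp at hv
  exact le_of_mul_le_mul_right (h3.trans h2) h4

theorem norm_det_le (X : V →L[ℂ] V) : ‖X.det‖ ≤ ∏ j : Fin (finrank ℂ V), sNum X (j + 1) := by
  obtain ⟨b, σ, h0, ha, hX, hd⟩ := exists_sv X
  rw [hd]
  exact Finset.prod_le_prod (fun i _ => h0 i) fun i _ => sv_le_sNum X b σ h0 ha hX i

theorem norm_trace_le (X : V →L[ℂ] V) :
    ‖LinearMap.trace ℂ V (X : V →ₗ[ℂ] V)‖ ≤ ∑ j : Fin (finrank ℂ V), sNum X (j + 1) := by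
  obtain ⟨b, σ, h0, ha, hX, hd⟩ := exists_sv X
  rw [LinearMap.trace_eq_sum_inner _ b]
  refine (norm_sum_le _ _).trans (Finset.sum_le_sum fun i _ => ?_)
  refine le_trans ?_ (sv_le_sNum X b σ h0 ha hX i)
  have h1 := hX (fun k => if k = i then 1 else 0)
  simp only [ite_smul, one_smul, zero_smul, Finset.sum_ite_eq', Finset.mem_univ, if_true] at h1
  have h2 : ‖X (b i)‖ ^ 2 = σ i ^ 2 := by
    rw [h1, Finset.sum_eq_single i]
    · simp
    · intro k _ hk; simp [hk]
    · simp
  have h3 : ‖X (b i)‖ = σ i := (pow_left_inj₀ (norm_nonneg _) (h0 i) two_ne_zero).1 h2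
  have := norm_inner_le_norm (𝕜 := ℂ) (b i) (X (b i))
  rw [h3, b.orthonormal.1 i, one_mul] at this
  exact this

theorem sNum_eq_zero (X : V →L[ℂ] V) {j : ℕ} (hj : finrank ℂ V ≤ j) : sNum X (j + 1) = 0 := by
  refine le_antisymm ?_ (sNum_nonneg _ _)
  have := sNum_le X X (n := j + 1) ?_
  · simpa using this
  · refine (LinearMap.rank_le_domain _).trans_lt ?_
    rw [← finrank_eq_rank]
    exact_mod_cast Nat.lt_succ_of_le hj

/-- eigen-data of a positive operator -/
theorem exists_pos_eig (C : V →L[ℂ] V) (hC : C.IsPositive) :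
    ∃ (b : OrthonormalBasis (Fin (finrank ℂ V)) ℂ V) (c : Fin (finrank ℂ V) → ℝ),
    (∀ i, 0 ≤ c i) ∧ (∀ i, C (b i) = (c i : ℂ) • b i) ∧ ∀ i : Fin (finrank ℂ V), sNum C (i + 1) ≤ c i := by
  classical
  have hp : (C : V →ₗ[ℂ] V).IsPositive := (ContinuousLinearMap.isPositive_toLinearMap_iff C).2 hC
  have hs := hp.isSymmetric
  let b := hs.eigenvectorBasis rfl
  let μ := hs.eigenvalues rfl
  have hμ : ∀ i, 0 ≤ μ i := fun i => hp.nonneg_eigenvalues rfl i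
  have hμa : Antitone μ := hs.eigenvalues_antitone rfl
  have hb : ∀ i, C (b i) = (μ i : ℂ) • b i := fun i => hs.apply_eigenvectorBasis rfl i
  refine ⟨b, μ, hμ, hb, fun j => ?_⟩
  let F : V →L[ℂ] V := ∑ i ∈ Finset.Iio j, (μ i : ℂ) • InnerProductSpace.rankOne ℂ (b i) (b i)
  have hFa : ∀ v, F v = ∑ i ∈ Finset.Iio j, ((μ i : ℂ) * inner ℂ (b i) v) • b i := by
    intro v
    simp only [F, sum_apply, smul_apply, InnerProductSpace.rankOne_apply]
    exact Finset.sum_congr rfl fun i _ => by rw [mul_smul]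
  have hFr : LinearMap.rank (F : V →ₗ[ℂ] V) < ((j : ℕ) + 1 : ℕ) := by
    have h1 : LinearMap.range (F : V →ₗ[ℂ] V) ≤ Submodule.span ℂ ((Finset.Iio j).image b : Finset V) := by
      rintro _ ⟨v, rfl⟩
      have : (F : V →ₗ[ℂ] V) v = F v := rfl
      rw [this, hFa]
      refine Submodule.sum_mem _ fun i hi => Submodule.smul_mem _ _ (Submodule.subset_span ?_)
      exact Finset.mem_coe.2 (Finset.mem_image_of_mem _ hi)
    have h2 := Submodule.rank_mono h1
    have h3 : ((Finset.Iio j).image b).card ≤ j := Finset.card_image_le.trans (by simp)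
    refine (h2.trans (rank_span_finset_le _)).trans_lt ?_
    exact_mod_cast Nat.lt_succ_of_le h3
  refine (sNum_le C F hFr).trans ?_
  refine ContinuousLinearMap.opNorm_le_bound _ (hμ j) fun v => ?_
  have hv : v = ∑ i, inner ℂ (b i) v • b i := by
    have := b.sum_repr v
    simp only [OrthonormalBasis.repr_apply_apply] at this
    exact this.symm
  have hCv : C v = ∑ i, ((μ i : ℂ) * inner ℂ (b i) v) • b i := by
    conv_lhs => rw [hv]
    rw [map_sum]
    refine Finset.sum_congr rfl fun i _ => ?_
    rw [map_smul, hb, smul_smul, mul_comm]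
  have hd : (C - F) v = ∑ i, (if i < j then 0 else (μ i : ℂ) * inner ℂ (b i) v) • b i := by
    rw [sub_apply, hCv, hFa, sub_eq_iff_eq_add]
    have : ∑ i ∈ Finset.Iio j, ((μ i : ℂ) * inner ℂ (b i) v) • b i =
        ∑ i, (if i < j then (μ i : ℂ) * inner ℂ (b i) v else 0) • b i := by
      simp only [ite_smul, zero_smul]
      rw [← Finset.sum_filter]
      refine Finset.sum_congr (by ext; simp) fun _ _ => rfl
    rw [this, ← Finset.sum_add_distrib]
    refine Finset.sum_congr rfl fun i _ => ?_
    split_ifs <;> simp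
  refine le_of_sq_le_sq ?_ (mul_nonneg (hμ j) (norm_nonneg _))
  rw [hd, norm_sq_sum, mul_pow, ← OrthonormalBasis.sum_sq_norm_inner_right b v, Finset.mul_sum]
  refine Finset.sum_le_sum fun i _ => ?_
  split_ifs with h
  · simp; positivity
  · rw [norm_mul, mul_pow, Complex.norm_real, Real.norm_eq_abs, sq_abs]
    have := hμa (not_lt.1 h)
    have := hμ i
    gcongr

theorem det_diag (X : V →L[ℂ] V) (b : OrthonormalBasis (Fin (finrank ℂ V)) ℂ V)
    (c : Fin (finrank ℂ V) → ℂ) (h : ∀ i, X (b i) = c i • b i) : X.det = ∏ i, c i := by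
  have : LinearMap.toMatrix b.toBasis b.toBasis (X : V →ₗ[ℂ] V) = Matrix.diagonal c := by
    ext i j
    rw [LinearMap.toMatrix_apply]
    simp [h, Matrix.diagonal_apply, Pi.single_apply]
    aesop
  change LinearMap.det (X : V →ₗ[ℂ] V) = _
  rw [← LinearMap.det_toMatrix b.toBasis, this, Matrix.det_diagonal]

theorem exists_eig (A : V →L[ℂ] V) : ∃ (m : ℕ) (l : Fin m → ℂ),
    (∀ w : ℂ, (1 + w • A).det = ∏ i, (1 + w * l i)) ∧
    (∀ i, Module.End.HasEigenvalue (A : V →ₗ[ℂ] V) (l i)) ∧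
    LinearMap.trace ℂ V (A : V →ₗ[ℂ] V) = ∑ i, l i := by
  set L : V →ₗ[ℂ] V := (A : V →ₗ[ℂ] V) with hL
  have hsp : L.charpoly.Splits := IsAlgClosed.splits _
  obtain ⟨s, hs⟩ := Quot.exists_rep L.charpoly.roots
  have hs' : L.charpoly.roots = (s : Multiset ℂ) := hs.symm
  have hprod : ∀ f : ℂ → ℂ, (L.charpoly.roots.map f).prod = ∏ i, f (s.get i) := by
    intro f
    rw [hs', Multiset.map_coe, Multiset.prod_coe, ← List.ofFn_get (s.map f), List.prod_ofFn]
    refine Fintype.prod_equiv (finCongr (by simp)) _ _ fun i => ?_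
    simp
  refine ⟨s.length, s.get, fun w => ?_, fun i => ?_, ?_⟩
  · have hX : (1 + w • A).det = LinearMap.det (1 + w • L) := rfl
    rw [hX, ← hprod (fun x => 1 + w * x)]
    by_cases hw : w = 0
    · subst hw; simp
    have h1 := LinearMap.eval_charpoly L (-w⁻¹)
    have h2 : (1 + w • L) = (-w) • ((algebraMap ℂ (V →ₗ[ℂ] V)) (-w⁻¹) - L) := by
      rw [Algebra.algebraMap_eq_smul_one, smul_sub, smul_smul]
      simp [hw]
    rw [h2, LinearMap.det_smul, ← h1]
    conv_lhs => rw [hsp.eq_prod_roots_of_monic L.charpoly_monic]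
    rw [Polynomial.eval_multiset_prod, Multiset.map_map]
    have hcard : Module.finrank ℂ V = Multiset.card L.charpoly.roots := by
      rw [← LinearMap.charpoly_natDegree L]
      exact hsp.natDegree_eq_card_roots
    rw [hcard, ← Multiset.prod_replicate, ← Multiset.map_const', ← Multiset.prod_map_mul]
    refine congrArg Multiset.prod (Multiset.map_congr rfl fun x _ => ?_)
    simp only [Function.comp, Polynomial.eval_sub, Polynomial.eval_X, Polynomial.eval_C]
    field_simp
    ring
  · rw [Module.End.hasEigenvalue_iff_isRoot_charpoly]
    have : s.get i ∈ L.charpoly.roots := by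
      rw [hs']; exact Multiset.mem_coe.2 (List.get_mem s i)
    exact (Polynomial.mem_roots'.1 this).2
  · rw [Module.End.trace_eq_sum_roots_charpoly_of_splits hsp, hs', Multiset.sum_coe]
    conv_lhs => rw [← List.ofFn_get s]
    rw [List.sum_ofFn]

/-- the key determinant inequality -/
theorem det_ineq (C T : V →L[ℂ] V) (hC : C.IsPositive) (w : ℂ) (δ : ℝ) (hδ : 0 < δ)
    (hw : ∀ c : ℝ, 0 ≤ c → δ ≤ ‖1 + w * c‖) :
    ‖(1 + w • (C + T)).det‖ ≤ ‖(1 + w • C).det‖ *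
      ∏ j : Fin (finrank ℂ V), (1 + ‖w‖ / δ * sNum T (j + 1)) := by
  set N : V →L[ℂ] V := 1 + w • C with hN
  have hlow : ∀ v, δ * ‖v‖ ≤ ‖N v‖ := by
    intro v
    by_cases hv : v = 0
    · simp [hv]
    have hv' : 0 < ‖v‖ := norm_pos_iff.2 hv
    obtain ⟨r, hr0, hr⟩ : ∃ r : ℝ, 0 ≤ r ∧ inner ℂ v (C v) = (r : ℂ) := by
      have h := hC.inner_nonneg_right v
      rw [Complex.le_def] at h
      refine ⟨(inner ℂ v (C v)).re, by simpa using h.1, ?_⟩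
      apply Complex.ext
      · simp
      · simpa using h.2.symm
    have h1 : inner ℂ v (N v) = (‖v‖ ^ 2 : ℂ) * (1 + w * ((r / ‖v‖ ^ 2 : ℝ) : ℂ)) := by
      have hv2 : (‖v‖ : ℂ) ≠ 0 := by exact_mod_cast hv'.ne'
      simp only [hN, add_apply, one_apply_eq_self,
        smul_apply, inner_add_right, inner_smul_right, hr,
        inner_self_eq_norm_sq_to_K]
      push_cast
      field_simp
      simp
    have h2 := norm_inner_le_norm (𝕜 := ℂ) v (N v)
    rw [h1, norm_mul, norm_pow, Complex.norm_real, norm_norm] at h2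
    have h3 := hw (r / ‖v‖ ^ 2) (by positivity)
    have h4 : ‖v‖ * (δ * ‖v‖) ≤ ‖v‖ * ‖N v‖ := by
      refine le_trans ?_ h2
      calc ‖v‖ * (δ * ‖v‖) = ‖v‖ ^ 2 * δ := by ring
        _ ≤ _ := by gcongr
    exact le_of_mul_le_mul_left h4 hv'
  have hinj : Function.Injective (N : V →ₗ[ℂ] V) := by
    rw [← LinearMap.ker_eq_bot, LinearMap.ker_eq_bot']
    intro v hv
    have h := hlow v
    have hv2 : N v = 0 := hv
    rw [hv2, norm_zero] at h
    by_contra hne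
    have := mul_pos hδ (norm_pos_iff.2 hne)
    linarith
  let e := LinearEquiv.ofInjectiveEndo (N : V →ₗ[ℂ] V) hinj
  let R : V →L[ℂ] V := LinearMap.toContinuousLinearMap (e.symm : V →ₗ[ℂ] V)
  have hNR : ∀ v, N (R v) = v := fun v => e.apply_symm_apply v
  have hRn : ‖R‖ ≤ 1 / δ := by
    refine ContinuousLinearMap.opNorm_le_bound _ (by positivity) fun v => ?_
    have := hlow (R v)
    rw [hNR] at this
    rw [div_mul_eq_mul_div, one_mul, le_div_iff₀ hδ]
    linarith
  have hfac : 1 + w • (C + T) = N * (1 + w • (R * T)) := by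
    ext v
    simp only [add_apply, one_apply_eq_self,
        smul_apply, mul_apply_eq_comp, map_add, map_smul, hNR]
    simp [hN, add_assoc]
  have hdet : (N * (1 + w • (R * T))).det = N.det * (1 + w • (R * T)).det :=
    LinearMap.det_comp (N : V →ₗ[ℂ] V) ((1 + w • (R * T) : V →L[ℂ] V) : V →ₗ[ℂ] V)
  rw [hfac, hdet, norm_mul]
  refine mul_le_mul_of_nonneg_left ((norm_det_le _).trans ?_) (norm_nonneg _)
  refine Finset.prod_le_prod (fun i _ => sNum_nonneg _ _) fun i _ => ?_
  refine (sNum_one_add_le _ (by omega)).trans ?_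
  gcongr
  refine (sNum_smul_le _ _ (by omega)).trans ?_
  rw [div_mul_eq_mul_div, mul_div_assoc]
  gcongr
  refine (sNum_mul_left_le _ _ (by omega)).trans ?_
  calc ‖R‖ * sNum T (i + 1) ≤ 1 / δ * sNum T (i + 1) := by
        have := sNum_nonneg T (i + 1)
        gcongr
    _ = _ := by ring

theorem det_one_add_le (A : V →L[ℂ] V) (w : ℂ) :
    ‖(1 + w • A).det‖ ≤ ∏ j : Fin (finrank ℂ V), (1 + ‖w‖ * sNum A (j + 1)) := by
  refine (norm_det_le _).trans ?_
  refine Finset.prod_le_prod (fun i _ => sNum_nonneg _ _) fun i _ => ?_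
  refine (sNum_one_add_le _ (by omega)).trans ?_
  gcongr
  exact sNum_smul_le _ _ (by omega)

end findim
end SV

namespace SV
section mellin
open MeasureTheory Set

/-- The dominating function. -/
noncomputable def dom (s x : ℝ) : ℝ := Real.log (1 + x) * x ^ (-1 - s)

theorem dom_nonneg (s : ℝ) {x : ℝ} (hx : 0 < x) : 0 ≤ dom s x :=
  mul_nonneg (Real.log_nonneg (by linarith)) (Real.rpow_nonneg hx.le _)

theorem dom_integrable {s : ℝ} (h0 : 0 < s) (h1 : s < 1) : IntegrableOn (dom s) (Ioi 0) := by
  have hc : ContinuousOn (dom s) (Ioi 0) := by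
    intro x hx
    have hx : 0 < x := hx
    refine ContinuousAt.continuousWithinAt ?_
    unfold dom
    refine ContinuousAt.mul ?_ ?_
    · exact ContinuousAt.log (by fun_prop) (by positivity)
    · exact Real.continuousAt_rpow_const _ _ (Or.inl hx.ne')
  rw [← Ioc_union_Ioi_eq_Ioi (zero_le_one' ℝ)]
  refine IntegrableOn.union ?_ ?_
  · have h2 : IntegrableOn (fun x : ℝ => x ^ (-s)) (Ioc 0 1) := by
      rw [← intervalIntegrable_iff_integrableOn_Ioc_of_le zero_le_one]
      exact intervalIntegral.intervalIntegrable_rpow' (by linarith)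
    refine Integrable.mono' h2 ((hc.mono Ioc_subset_Ioi_self).aestronglyMeasurable measurableSet_Ioc) ?_
    refine (ae_restrict_iff' measurableSet_Ioc).2 (Eventually.of_forall fun x hx => ?_)
    have hx0 : 0 < x := hx.1
    rw [Real.norm_of_nonneg (dom_nonneg s hx0)]
    have : Real.log (1 + x) ≤ x := by
      have := Real.log_le_sub_one_of_pos (x := 1 + x) (by positivity); linarith
    calc dom s x ≤ x * x ^ (-1 - s) := mul_le_mul_of_nonneg_right this (Real.rpow_nonneg hx0.le _)
      _ = x ^ (-s) := by
        rw [← Real.rpow_one_add' hx0.le (by linarith)]; congr 1; ring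
  · have h2 : IntegrableOn (fun x : ℝ => (2 ^ (s/2) / (s/2)) * x ^ (-1 - s/2)) (Ioi 1) :=
      (integrableOn_Ioi_rpow_of_lt (by linarith) one_pos).const_mul _
    refine Integrable.mono' h2 ((hc.mono (Ioi_subset_Ioi zero_le_one)).aestronglyMeasurable measurableSet_Ioi) ?_
    refine (ae_restrict_iff' measurableSet_Ioi).2 (Eventually.of_forall fun x hx => ?_)
    have hx1 : 1 < x := hx
    have hx0 : 0 < x := by linarith
    rw [Real.norm_of_nonneg (dom_nonneg s hx0)]
    have h3 : Real.log (1 + x) ≤ (2 * x) ^ (s/2) / (s/2) :=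
      (Real.log_le_rpow_div (by positivity) (by linarith : 0 < s / 2)).trans
        (div_le_div_of_nonneg_right (Real.rpow_le_rpow (by positivity) (by linarith) (by linarith)) (by linarith))
    calc dom s x ≤ (2 * x) ^ (s/2) / (s/2) * x ^ (-1 - s) :=
          mul_le_mul_of_nonneg_right h3 (Real.rpow_nonneg hx0.le _)
      _ = (2 ^ (s/2) / (s/2)) * (x ^ (s/2) * x ^ (-1 - s)) := by
        rw [Real.mul_rpow (by norm_num) hx0.le]; ring
      _ = _ := by rw [← Real.rpow_add hx0]; congr 2; ring

theorem slit_lower {w : ℂ} (hw : w ∈ Complex.slitPlane) :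
    ∃ c > 0, ∀ x : ℝ, 0 ≤ x → c * (1 + x) ≤ ‖1 + x * w‖ := by
  have hmem : ∀ t ∈ Icc (0:ℝ) 1, (1 - t : ℂ) + t * w ≠ 0 := by
    intro t ht
    have := Complex.starConvex_one_slitPlane hw (a := 1 - t) (b := t) (by linarith [ht.2]) ht.1 (by ring)
    have := Complex.slitPlane_ne_zero this
    simpa using this
  obtain ⟨t0, ht0, hmin⟩ := isCompact_Icc.exists_isMinOn (⟨0, by simp⟩ : (Icc (0:ℝ) 1).Nonempty)
    (f := fun t : ℝ => ‖(1 - t : ℂ) + t * w‖) (by fun_prop)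
  refine ⟨‖(1 - t0 : ℂ) + t0 * w‖, norm_pos_iff.2 (hmem t0 ht0), fun x hx => ?_⟩
  have h1 : (0:ℝ) < 1 + x := by linarith
  have h2 := hmin (a := x / (1 + x)) ⟨by positivity, by rw [div_le_one h1]; linarith⟩
  simp only [mem_ofPred_eq] at h2
  have h3 : (1:ℂ) + x * w = ((1 - (x / (1 + x) : ℝ) : ℂ) + (x / (1 + x) : ℝ) * w) * (1 + x : ℝ) := by
    have : ((1:ℂ) + x) ≠ 0 := by exact_mod_cast h1.ne'
    push_cast
    field_simp
    ring
  rw [h3, norm_mul, Complex.norm_real, Real.norm_of_nonneg h1.le]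
  exact mul_le_mul_of_nonneg_right h2 h1.le

theorem slit_one_add {w : ℂ} (hw : w ∈ Complex.slitPlane) {x : ℝ} (hx : 0 ≤ x) :
    1 + x * w ∈ Complex.slitPlane := by
  have h1 : (0:ℝ) < 1 + x := by linarith
  have := Complex.starConvex_one_slitPlane hw (a := 1 / (1 + x)) (b := x / (1 + x)) (by positivity)
    (by positivity) (by field_simp)
  rw [Complex.mem_slitPlane_iff] at this ⊢
  have e : (1:ℂ) + x * w = (1 + x : ℝ) * ((1 / (1 + x)) • (1:ℂ) + (x / (1 + x)) • w) := by
    have : ((1:ℂ) + x) ≠ 0 := by exact_mod_cast h1.ne'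
    simp only [Complex.real_smul]
    push_cast
    field_simp
  rw [e, Complex.re_ofReal_mul, Complex.im_ofReal_mul]
  rcases this with h | h
  · exact Or.inl (mul_pos h1 h)
  · exact Or.inr (mul_ne_zero h1.ne' h)

theorem norm_log_le {w : ℂ} (hw : w ∈ Complex.slitPlane) {c : ℝ} (hc : 0 < c)
    (h : ∀ x : ℝ, 0 ≤ x → c * (1 + x) ≤ ‖1 + x * w‖) {x : ℝ} (hx : 0 ≤ x) :
    ‖Complex.log (1 + x * w)‖ ≤ ‖w‖ / c * Real.log (1 + x) := by
  have hd : ∀ y : ℝ, 0 ≤ y → HasDerivAt (fun y : ℝ => Complex.log (1 + y * w)) (w / (1 + y * w)) y := by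
    intro y hy
    have h1 : HasDerivAt (fun y : ℝ => (1:ℂ) + y * w) (1 * w) y :=
      ((Complex.ofRealCLM.hasDerivAt (x := y)).mul_const w).const_add 1
    rw [one_mul] at h1
    exact h1.clog_real (slit_one_add hw hy)
  refine image_norm_le_of_norm_deriv_right_le_deriv_boundary' (a := 0) (b := x)
    (f := fun y : ℝ => Complex.log (1 + y * w)) (f' := fun y => w / (1 + y * w))
    (B := fun y => ‖w‖ / c * Real.log (1 + y)) (B' := fun y => ‖w‖ / c * (1 / (1 + y)))
    (fun y hy => (hd y hy.1).continuousAt.continuousWithinAt)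
    (fun y hy => (hd y hy.1).hasDerivWithinAt) (by simp) ?_ ?_ ?_ ⟨hx, le_rfl⟩
  · intro y hy
    have : (1 + y) ≠ 0 := by linarith [hy.1]
    exact ((ContinuousAt.log (by fun_prop) this).const_mul _).continuousWithinAt
  · intro y hy
    have : (1 + y) ≠ 0 := by linarith [hy.1]
    exact ((((hasDerivAt_id y).const_add 1).log this).const_mul _).hasDerivWithinAt
  · intro y hy
    have h0 : 0 < 1 + y := by linarith [hy.1]
    rw [norm_div]
    have := h y hy.1
    calc ‖w‖ / ‖1 + y * w‖ ≤ ‖w‖ / (c * (1 + y)) := by gcongr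
      _ = _ := by field_simp

theorem cont_F {w : ℂ} (hw : w ∈ Complex.slitPlane) (s : ℝ) :
    ContinuousOn (fun x : ℝ => Complex.log (1 + x * w) * (x ^ (-1 - s) : ℝ)) (Ioi 0) := by
  intro x hx
  have hx : 0 < x := hx
  refine ContinuousAt.continuousWithinAt ?_
  refine ContinuousAt.mul ?_ ?_
  · exact ContinuousAt.clog (by fun_prop) (slit_one_add hw hx.le)
  · exact Complex.continuous_ofReal.continuousAt.comp (Real.continuousAt_rpow_const _ _ (Or.inl hx.ne'))

theorem int_F {w : ℂ} (hw : w ∈ Complex.slitPlane) {s : ℝ} (h0 : 0 < s) (h1 : s < 1) :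
    IntegrableOn (fun x : ℝ => Complex.log (1 + x * w) * (x ^ (-1 - s) : ℝ)) (Ioi 0) := by
  obtain ⟨c, hc, h⟩ := slit_lower hw
  refine Integrable.mono' ((dom_integrable h0 h1).const_mul (‖w‖ / c))
    ((cont_F hw s).aestronglyMeasurable measurableSet_Ioi) ?_
  refine (ae_restrict_iff' measurableSet_Ioi).2 (Eventually.of_forall fun x hx => ?_)
  have hx : 0 < x := hx
  rw [norm_mul, Complex.norm_real, Real.norm_of_nonneg (Real.rpow_nonneg hx.le _), dom, ← mul_assoc]
  exact mul_le_mul_of_nonneg_right (norm_log_le hw hc h hx.le) (Real.rpow_nonneg hx.le _)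

/-- The transform of the logarithm. -/
noncomputable def G (s : ℝ) (w : ℂ) : ℂ :=
  ∫ x in Ioi (0:ℝ), Complex.log (1 + x * w) * (x ^ (-1 - s) : ℝ)

theorem log_lower {x : ℝ} (hx : 0 < x) : x / (1 + x) ≤ Real.log (1 + x) := by
  have := Real.one_sub_inv_le_log_of_pos (x := 1 + x) (by linarith)
  have h : 1 - (1 + x)⁻¹ = x / (1 + x) := by field_simp; ring
  linarith

theorem G_diff {w : ℂ} (hw : w ∈ Complex.slitPlane) {s : ℝ} (h0 : 0 < s) (h1 : s < 1) :
    DifferentiableAt ℂ (G s) w := by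
  obtain ⟨c, hc, h⟩ := slit_lower hw
  have hs : Metric.ball w (c / 2) ∩ Complex.slitPlane ∈ 𝓝 w :=
    inter_mem (Metric.ball_mem_nhds _ (by positivity)) (Complex.isOpen_slitPlane.mem_nhds hw)
  refine (hasDerivAt_integral_of_dominated_loc_of_deriv_le (μ := volume.restrict (Ioi (0:ℝ)))
    (F := fun w x => Complex.log (1 + x * w) * (x ^ (-1 - s) : ℝ))
    (F' := fun w x => (x / (1 + x * w)) * (x ^ (-1 - s) : ℝ)) (bound := fun x => 2 / c * dom s x) hs ?_
    (int_F hw h0 h1) ?_ ?_ ((dom_integrable h0 h1).const_mul _) ?_).2.differentiableAt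
  · filter_upwards [hs] with v hv
    exact (cont_F hv.2 s).aestronglyMeasurable measurableSet_Ioi
  · refine ContinuousOn.aestronglyMeasurable ?_ measurableSet_Ioi
    intro x hx
    have hx : 0 < x := hx
    refine ContinuousAt.continuousWithinAt (ContinuousAt.mul ?_ ?_)
    · refine ContinuousAt.div (by fun_prop) (by fun_prop) (Complex.slitPlane_ne_zero (slit_one_add hw hx.le))
    · exact Complex.continuous_ofReal.continuousAt.comp (Real.continuousAt_rpow_const _ _ (Or.inl hx.ne'))
  · refine (ae_restrict_iff' measurableSet_Ioi).2 (Eventually.of_forall fun x hx v hv => ?_)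
    have hx : 0 < x := hx
    have hlow : c / 2 * (1 + x) ≤ ‖1 + x * v‖ := by
      have e : (1:ℂ) + x * w = (1 + x * v) - x * (v - w) := by ring
      have h2 := h x hx.le
      rw [e] at h2
      have h3 := norm_sub_le ((1:ℂ) + x * v) (x * (v - w))
      rw [norm_mul, Complex.norm_real, Real.norm_of_nonneg hx.le] at h3
      have h4 : ‖v - w‖ < c / 2 := by simpa [dist_eq_norm] using hv.1
      nlinarith
    rw [norm_mul, norm_div, Complex.norm_real, Complex.norm_real, Real.norm_of_nonneg hx.le,
      Real.norm_of_nonneg (Real.rpow_nonneg hx.le _), dom, ← mul_assoc]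
    refine mul_le_mul_of_nonneg_right ?_ (Real.rpow_nonneg hx.le _)
    calc x / ‖1 + x * v‖ ≤ x / (c / 2 * (1 + x)) := by gcongr
      _ = 2 / c * (x / (1 + x)) := by field_simp
      _ ≤ _ := mul_le_mul_of_nonneg_left (log_lower hx) (by positivity)
  · refine (ae_restrict_iff' measurableSet_Ioi).2 (Eventually.of_forall fun x hx v hv => ?_)
    have hx : 0 < x := hx
    have h1 : HasDerivAt (fun v : ℂ => (1:ℂ) + x * v) (x * 1) v :=
      ((hasDerivAt_id v).const_mul (x:ℂ)).const_add 1
    rw [mul_one] at h1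
    exact (h1.clog (slit_one_add hv.2 hx.le)).mul_const _

theorem G_pos {s : ℝ} {t : ℝ} (ht : 0 < t) : G s t = ((t ^ s : ℝ) : ℂ) * G s 1 := by
  unfold G
  have := integral_comp_mul_left_Ioi' (fun x : ℝ => Complex.log (1 + x * 1) * (x ^ (-1 - s) : ℝ)) 0 ht
  rw [mul_zero] at this
  rw [← this, Complex.real_smul, ← mul_assoc, ← integral_const_mul]
  refine setIntegral_congr_fun measurableSet_Ioi fun x hx => ?_
  have hx : 0 < x := hx
  rw [Real.mul_rpow ht.le hx.le]
  have e : t ^ s * t * t ^ (-1 - s) = 1 := by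
    rw [← Real.rpow_add_one ht.ne', ← Real.rpow_add ht, show s + 1 + (-1 - s) = 0 by ring, Real.rpow_zero]
  have e' : ((t ^ s : ℝ) : ℂ) * t * (t ^ (-1 - s) : ℝ) = 1 := by exact_mod_cast e
  have e2 : ((t * x : ℝ) : ℂ) * 1 = x * t := by push_cast; ring
  rw [e2]
  push_cast at e' ⊢
  linear_combination (-(Complex.log (1 + x * t) * ((x ^ (-1 - s) : ℝ) : ℂ))) * e'

theorem G_eq {w : ℂ} (hw : w ∈ Complex.slitPlane) {s : ℝ} (h0 : 0 < s) (h1 : s < 1) :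
    G s w = w ^ (s : ℂ) * G s 1 := by
  have hA : AnalyticOnNhd ℂ (G s) Complex.slitPlane :=
    DifferentiableOn.analyticOnNhd (fun v hv => (G_diff hv h0 h1).differentiableWithinAt)
      Complex.isOpen_slitPlane
  have hB : AnalyticOnNhd ℂ (fun w : ℂ => w ^ (s : ℂ) * G s 1) Complex.slitPlane :=
    DifferentiableOn.analyticOnNhd (fun v hv => ((differentiableAt_id.cpow_const hv).mul_const _).differentiableWithinAt)
      Complex.isOpen_slitPlane
  refine hA.eqOn_of_preconnected_of_frequently_eq hB
    (Complex.starConvex_one_slitPlane.isPathConnected Complex.one_mem_slitPlane).isConnected.isPreconnected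
    Complex.one_mem_slitPlane ?_ hw
  have ht : Tendsto (fun t : ℝ => (t : ℂ)) (𝓝[>] 1) (𝓝[≠] 1) := by
    refine tendsto_nhdsWithin_of_tendsto_nhds_of_eventually_within _ ?_ ?_
    · have : Tendsto (fun t : ℝ => (t : ℂ)) (𝓝 1) (𝓝 ((1:ℝ):ℂ)) := Complex.continuous_ofReal.tendsto _
      simpa using this.mono_left nhdsWithin_le_nhds
    · filter_upwards [self_mem_nhdsWithin] with t ht
      have : (1:ℝ) < t := ht
      have h2 : (t : ℂ) ≠ 1 := by exact_mod_cast this.ne'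
      exact h2
  refine ht.frequently (Eventually.frequently ?_)
  filter_upwards [self_mem_nhdsWithin] with t ht
  have ht : (1:ℝ) < t := ht
  rw [G_pos (by linarith), Complex.ofReal_cpow (by linarith)]

/-- The constant. -/
noncomputable def g (s : ℝ) : ℝ := ∫ x in Ioi (0:ℝ), dom s x

theorem G_one (s : ℝ) : G s 1 = (g s : ℂ) := by
  unfold G g
  rw [← integral_complex_ofReal]
  refine setIntegral_congr_fun measurableSet_Ioi fun x hx => ?_
  have hx : 0 < x := hx
  simp only [dom, mul_one]
  push_cast
  rw [Complex.ofReal_log (by linarith)]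
  push_cast; rfl

theorem g_pos {s : ℝ} (h0 : 0 < s) (h1 : s < 1) : 0 < g s := by
  unfold g
  rw [setIntegral_pos_iff_support_of_nonneg_ae]
  · have : Ioi (0:ℝ) ⊆ Function.support (dom s) := by
      intro x hx
      have hx : 0 < x := hx
      exact (mul_pos (Real.log_pos (by linarith)) (Real.rpow_pos_of_pos hx _)).ne'
    rw [inter_eq_right.2 this]; simp
  · exact (ae_restrict_iff' measurableSet_Ioi).2 (Eventually.of_forall fun x hx => dom_nonneg s hx)
  · exact dom_integrable h0 h1

theorem log_norm_int {w : ℂ} (hw : w ∈ Complex.slitPlane ∨ w = 0) {s : ℝ} (h0 : 0 < s) (h1 : s < 1) :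
    IntegrableOn (fun x : ℝ => Real.log ‖1 + x * w‖ * x ^ (-1 - s)) (Ioi 0) ∧
    ∫ x in Ioi (0:ℝ), Real.log ‖1 + x * w‖ * x ^ (-1 - s) = (w ^ (s : ℂ)).re * g s := by
  rcases hw with hw | rfl
  · have e : (fun x : ℝ => Real.log ‖1 + x * w‖ * x ^ (-1 - s)) =
        fun x : ℝ => (Complex.log (1 + x * w) * (x ^ (-1 - s) : ℝ)).re := by
      ext x
      rw [Complex.re_mul_ofReal, Complex.log_re]
    rw [e]
    have hi := int_F hw h0 h1
    refine ⟨hi.re, ?_⟩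
    have := integral_re hi
    simp only [RCLike.re_to_complex] at this
    rw [this]
    have h2 := G_eq hw h0 h1
    rw [G_one] at h2
    unfold G at h2
    rw [h2, Complex.re_mul_ofReal]
  · have : (s:ℂ) ≠ 0 := by exact_mod_cast h0.ne'
    simp [this]

theorem mellin_ineq {ι κ : Type*} [Fintype ι] [Fintype κ] (w : ι → ℂ) (v : κ → ℂ)
    (hw : ∀ i, w i ∈ Complex.slitPlane ∨ w i = 0) (hv : ∀ i, v i ∈ Complex.slitPlane ∨ v i = 0)
    (h : ∀ x : ℝ, 0 < x → ∏ i, ‖1 + x * w i‖ ≤ ∏ i, ‖1 + x * v i‖) {s : ℝ} (h0 : 0 < s) (h1 : s < 1) :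
    ∑ i, ((w i) ^ (s : ℂ)).re ≤ ∑ i, ((v i) ^ (s : ℂ)).re := by
  have hne : ∀ u : ℂ, (u ∈ Complex.slitPlane ∨ u = 0) → ∀ x : ℝ, 0 < x → ‖1 + x * u‖ ≠ 0 := by
    rintro u (hu | rfl) x hx
    · exact norm_ne_zero_iff.2 (Complex.slitPlane_ne_zero (slit_one_add hu hx.le))
    · simp
  have hg := g_pos h0 h1
  rw [← mul_le_mul_iff_left₀ hg, Finset.sum_mul, Finset.sum_mul]
  rw [← Finset.sum_congr rfl fun i _ => (log_norm_int (hw i) h0 h1).2,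
    ← Finset.sum_congr rfl fun i _ => (log_norm_int (hv i) h0 h1).2,
    ← integral_finsetSum _ fun i _ => (log_norm_int (hw i) h0 h1).1,
    ← integral_finsetSum _ fun i _ => (log_norm_int (hv i) h0 h1).1]
  refine setIntegral_mono_on (integrable_finsetSum _ fun i _ => (log_norm_int (hw i) h0 h1).1)
    (integrable_finsetSum _ fun i _ => (log_norm_int (hv i) h0 h1).1) measurableSet_Ioi fun x hx => ?_
  have hx : 0 < x := hx
  rw [← Finset.sum_mul, ← Finset.sum_mul]
  refine mul_le_mul_of_nonneg_right ?_ (Real.rpow_nonneg hx.le _)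
  rw [← Real.log_prod fun i _ => hne _ (hw i) x hx, ← Real.log_prod fun i _ => hne _ (hv i) x hx]
  refine Real.log_le_log (Finset.prod_pos fun i _ => (norm_nonneg _).lt_of_ne (hne _ (hw i) x hx).symm) (h x hx)
end mellin
end SV

namespace SV
section weyl
open MeasureTheory Set
open scoped Real

theorem jensen {m n : ℕ} (l : Fin m → ℂ) (σ : Fin n → ℝ) (hσ : ∀ j, 0 ≤ σ j)
    (h : ∀ z : ℂ, ∏ i, ‖1 + z * l i‖ ≤ ∏ j, (1 + ‖z‖ * σ j)) {r : ℝ} (hr : 0 < r) :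
    ∑ i, Real.posLog (r * ‖l i‖) ≤ ∑ j, Real.log (1 + r * σ j) := by
  have e1 : ∑ i, Real.posLog (r * ‖l i‖) =
      Real.circleAverage (fun z : ℂ => ∑ i, Real.log ‖z + r * l i‖) 0 1 := by
    rw [Real.circleAverage_fun_sum]
    · refine Finset.sum_congr rfl fun i _ => ?_
      rw [circleAverage_log_norm_add_const_eq_posLog, norm_mul, Complex.norm_real, Real.norm_of_nonneg hr.le]
    · intro i _
      exact MeromorphicOn.circleIntegrable_log_norm (fun z hz ↦ by fun_prop)
  have e2 : Real.circleAverage (fun z : ℂ => ∑ i, Real.log ‖z + r * l i‖) 0 1 =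
      Real.circleAverage (fun z : ℂ => Real.log ‖∏ i, (z + r * l i)‖) 0 1 := by
    refine Real.circleAverage_congr_codiscreteWithin ?_ one_ne_zero
    have hf : ((range fun i => - (r * l i)) : Set ℂ).Finite := Set.finite_range _
    filter_upwards [compl_finite_mem_codiscreteWithin hf] with z hz
    rw [norm_prod, Real.log_prod]
    intro i _ h0
    apply hz
    refine ⟨i, ?_⟩
    have := norm_eq_zero.1 h0
    linear_combination -this
  rw [e1, e2]
  refine Real.circleAverage_mono_on_of_le_circle
    (MeromorphicOn.circleIntegrable_log_norm (fun z hz ↦ by fun_prop)) fun z hz => ?_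
  have hz1 : ‖z‖ = 1 := by simpa using hz
  have hz0 : z ≠ 0 := by rintro rfl; simp at hz1
  have hpos : ∀ j, 0 < 1 + r * σ j := fun j => by have := hσ j; positivity
  rw [← Real.log_prod fun j _ => (hpos j).ne']
  by_cases h0 : ‖∏ i, (z + r * l i)‖ = 0
  · rw [h0, Real.log_zero]
    refine Real.log_nonneg ?_
    calc (1:ℝ) = ∏ j : Fin n, 1 := by simp
      _ ≤ _ := Finset.prod_le_prod (fun _ _ => zero_le_one) fun j _ => by
        have := hσ j; nlinarith
  · refine Real.log_le_log ((norm_nonneg _).lt_of_ne (Ne.symm h0)) ?_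
    have h2 := h (r * z⁻¹)
    rw [norm_mul, Complex.norm_real, Real.norm_of_nonneg hr.le, norm_inv, hz1, inv_one, mul_one] at h2
    refine le_trans (le_of_eq ?_) h2
    rw [norm_prod]
    refine Finset.prod_congr rfl fun i _ => ?_
    have : z + r * l i = z * (1 + r * z⁻¹ * l i) := by field_simp
    rw [this, norm_mul, hz1, one_mul]

/-- Second constant. -/
noncomputable def L (v : ℝ) : ℝ := ∫ x in Ioi (0:ℝ), Real.posLog x * x ^ (-1 - v)

theorem slit_nonneg {b : ℝ} (hb : 0 ≤ b) : (b : ℂ) ∈ Complex.slitPlane ∨ (b : ℂ) = 0 := by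
  rcases hb.eq_or_lt with h | h
  · right; simp [← h]
  · left; simpa using h

theorem log_real_int {b : ℝ} (hb : 0 ≤ b) {v : ℝ} (h0 : 0 < v) (h1 : v < 1) :
    IntegrableOn (fun x : ℝ => Real.log (1 + x * b) * x ^ (-1 - v)) (Ioi 0) ∧
    ∫ x in Ioi (0:ℝ), Real.log (1 + x * b) * x ^ (-1 - v) = b ^ v * g v := by
  have := log_norm_int (slit_nonneg hb) h0 h1
  have e : EqOn (fun x : ℝ => Real.log ‖1 + x * (b:ℂ)‖ * x ^ (-1 - v))
      (fun x : ℝ => Real.log (1 + x * b) * x ^ (-1 - v)) (Ioi 0) := by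
    intro x hx
    have hx : 0 < x := hx
    have : (1:ℂ) + x * b = ((1 + x * b : ℝ) : ℂ) := by push_cast; ring
    simp only [this, Complex.norm_real]
    rw [Real.norm_of_nonneg (by positivity)]
  rw [integrableOn_congr_fun e measurableSet_Ioi, setIntegral_congr_fun measurableSet_Ioi e] at this
  rw [← Complex.ofReal_cpow hb, Complex.ofReal_re] at this
  exact this

theorem posLog_le {x : ℝ} (hx : 0 ≤ x) : Real.posLog x ≤ Real.log (1 + x) := by
  rw [Real.posLog_eq_log_max_one hx]
  exact Real.log_le_log (by positivity) (max_le (by linarith) (by linarith))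

theorem posLog_int {b : ℝ} (hb : 0 ≤ b) {v : ℝ} (h0 : 0 < v) (h1 : v < 1) :
    IntegrableOn (fun x : ℝ => Real.posLog (x * b) * x ^ (-1 - v)) (Ioi 0) := by
  refine Integrable.mono' (log_real_int hb h0 h1).1 ?_ ?_
  · refine ContinuousOn.aestronglyMeasurable ?_ measurableSet_Ioi
    intro x hx
    have hx : 0 < x := hx
    refine ContinuousAt.continuousWithinAt (ContinuousAt.mul (by fun_prop) ?_)
    exact (Real.continuousAt_rpow_const _ _ (Or.inl hx.ne'))
  · refine (ae_restrict_iff' measurableSet_Ioi).2 (Eventually.of_forall fun x hx => ?_)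
    have hx : 0 < x := hx
    have := Real.rpow_nonneg hx.le (-1 - v)
    rw [Real.norm_of_nonneg (mul_nonneg Real.posLog_nonneg this)]
    exact mul_le_mul_of_nonneg_right (posLog_le (by positivity)) this

theorem posLog_scale {b : ℝ} (hb : 0 ≤ b) {v : ℝ} (h0 : 0 < v) :
    ∫ x in Ioi (0:ℝ), Real.posLog (x * b) * x ^ (-1 - v) = b ^ v * L v := by
  rcases hb.eq_or_lt with h | h
  · simp [← h, Real.zero_rpow h0.ne']
  · unfold L
    have := integral_comp_mul_left_Ioi' (fun x : ℝ => Real.posLog x * x ^ (-1 - v)) 0 h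
    rw [mul_zero] at this
    rw [← this, smul_eq_mul, ← mul_assoc, ← integral_const_mul]
    refine setIntegral_congr_fun measurableSet_Ioi fun x hx => ?_
    have hx : 0 < x := hx
    rw [Real.mul_rpow hb hx.le]
    have e : b ^ v * b * b ^ (-1 - v) = 1 := by
      rw [← Real.rpow_add_one h.ne', ← Real.rpow_add h, show v + 1 + (-1 - v) = 0 by ring, Real.rpow_zero]
    rw [mul_comm x b]
    linear_combination (-(Real.posLog (b * x) * x ^ (-1 - v))) * e

theorem L_pos {v : ℝ} (h0 : 0 < v) (h1 : v < 1) : 0 < L v := by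
  unfold L
  rw [setIntegral_pos_iff_support_of_nonneg_ae]
  · have : Ioi (1:ℝ) ⊆ Function.support (fun x : ℝ => Real.posLog x * x ^ (-1 - v)) ∩ Ioi 0 := by
      intro x hx
      have hx : 1 < x := hx
      refine ⟨?_, by simp; linarith⟩
      have h2 : 0 < Real.posLog x := by
        rw [Real.posLog_eq_log (hx.le.trans (le_abs_self x))]; exact Real.log_pos hx
      exact (mul_pos h2 (Real.rpow_pos_of_pos (by linarith) _)).ne'
    refine lt_of_lt_of_le ?_ (measure_mono this)
    simp
  · exact (ae_restrict_iff' measurableSet_Ioi).2 (Eventually.of_forall fun x hx =>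
      mul_nonneg Real.posLog_nonneg (Real.rpow_nonneg (le_of_lt hx) _))
  · simpa using posLog_int zero_le_one h0 h1

theorem weyl {m n : ℕ} (l : Fin m → ℂ) (σ : Fin n → ℝ) (hσ : ∀ j, 0 ≤ σ j)
    (h : ∀ z : ℂ, ∏ i, ‖1 + z * l i‖ ≤ ∏ j, (1 + ‖z‖ * σ j)) {v : ℝ} (h0 : 0 < v) (h1 : v < 1) :
    ∑ i, ‖l i‖ ^ v ≤ g v / L v * ∑ j, σ j ^ v := by
  have hL := L_pos h0 h1
  have key : (∑ i, ‖l i‖ ^ v) * L v ≤ (∑ j, σ j ^ v) * g v := by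
    rw [Finset.sum_mul, Finset.sum_mul]
    rw [← Finset.sum_congr rfl fun i _ => posLog_scale (norm_nonneg (l i)) h0,
      ← Finset.sum_congr rfl fun i _ => (log_real_int (hσ i) h0 h1).2,
      ← integral_finsetSum _ fun i _ => posLog_int (norm_nonneg (l i)) h0 h1,
      ← integral_finsetSum _ fun i _ => (log_real_int (hσ i) h0 h1).1]
    refine setIntegral_mono_on (integrable_finsetSum _ fun i _ => posLog_int (norm_nonneg (l i)) h0 h1)
      (integrable_finsetSum _ fun i _ => (log_real_int (hσ i) h0 h1).1) measurableSet_Ioi fun x hx => ?_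
    have hx : 0 < x := hx
    rw [← Finset.sum_mul, ← Finset.sum_mul]
    exact mul_le_mul_of_nonneg_right (jensen l σ hσ h hx) (Real.rpow_nonneg hx.le _)
  rw [div_mul_eq_mul_div, le_div_iff₀ hL]
  linarith
end weyl
end SV

namespace SV
universe u
section powers
open Asymptotics

/-- half, rounded up -/
def hf (n : ℕ) : ℕ := (n + 1) / 2

theorem hf_pos {n : ℕ} (hn : 1 ≤ n) : 1 ≤ hf n := by unfold hf; omega
theorem hf_add (n : ℕ) : hf n + hf n ≤ n + 1 := by unfold hf; omega
theorem hf_tendsto : Tendsto hf atTop atTop :=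
  tendsto_atTop_mono (f := fun n => n / 2) (fun n => by unfold hf; omega)
    (Nat.tendsto_div_const_atTop two_ne_zero)

theorem hf_bigO {β : ℝ} (hβ : 0 ≤ β) :
    (fun n : ℕ => ((hf n : ℕ) : ℝ) ^ (-β)) =O[atTop] fun n : ℕ => (n : ℝ) ^ (-β) := by
  refine IsBigO.of_bound ((2:ℝ) ^ β) ?_
  filter_upwards [eventually_ge_atTop 1] with n hn
  have h1 : (0:ℝ) < n := by exact_mod_cast hn
  have h2 : (n:ℝ) / 2 ≤ hf n := by
    have : n ≤ 2 * hf n := by unfold hf; omega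
    have : (n:ℝ) ≤ 2 * hf n := by exact_mod_cast this
    linarith
  have h3 : (0:ℝ) < hf n := by linarith
  rw [Real.norm_of_nonneg (by positivity), Real.norm_of_nonneg (by positivity)]
  calc (hf n : ℝ) ^ (-β) ≤ ((n:ℝ) / 2) ^ (-β) :=
        Real.rpow_le_rpow_of_nonpos (by positivity) h2 (by linarith)
    _ = _ := by
      rw [Real.div_rpow h1.le (by norm_num), Real.rpow_neg (by norm_num : (0:ℝ) ≤ 2), div_inv_eq_mul, mul_comm]

theorem bigO_hf {f : ℕ → ℝ} {β : ℝ} (hβ : 0 ≤ β) (h : f =O[atTop] fun n : ℕ => (n : ℝ) ^ (-β)) :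
    (fun n => f (hf n)) =O[atTop] fun n : ℕ => (n : ℝ) ^ (-β) :=
  (h.comp_tendsto hf_tendsto).trans (hf_bigO hβ)

theorem littleO_hf {f : ℕ → ℝ} {β : ℝ} (hβ : 0 ≤ β) (h : f =o[atTop] fun n : ℕ => (n : ℝ) ^ (-β)) :
    (fun n => f (hf n)) =o[atTop] fun n : ℕ => (n : ℝ) ^ (-β) :=
  (h.comp_tendsto hf_tendsto).trans_isBigO (hf_bigO hβ)

theorem rpow_mul_ev (β γ : ℝ) : (fun n : ℕ => (n : ℝ) ^ (-β) * (n : ℝ) ^ (-γ)) =ᶠ[atTop]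
    fun n : ℕ => (n : ℝ) ^ (-(β + γ)) := by
  filter_upwards [eventually_ge_atTop 1] with n hn
  have h1 : (0:ℝ) < n := by exact_mod_cast hn
  rw [← Real.rpow_add h1]; congr 1; ring

theorem powers {α : ℝ} (hα : 0 < α) (c t : ℕ → ℝ)
    (hc0 : ∀ n, 0 ≤ c n) (ht0 : ∀ n, 0 ≤ t n)
    (hc : c =O[atTop] fun n : ℕ => (n : ℝ) ^ (-α)) (ht : t =o[atTop] fun n : ℕ => (n : ℝ) ^ (-α))
    (k : ℕ) (hk : 1 ≤ k) : ∃ A τ : ℕ → ℝ, (∀ n, 0 ≤ A n) ∧ (∀ n, 0 ≤ τ n) ∧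
      (A =O[atTop] fun n : ℕ => (n : ℝ) ^ (-(k * α))) ∧
      (τ =o[atTop] fun n : ℕ => (n : ℝ) ^ (-(k * α))) ∧
      ∀ (V : Type u) [NormedAddCommGroup V] [InnerProductSpace ℂ V] (C T : V →L[ℂ] V),
        (∀ n, 1 ≤ n → sNum C n ≤ c n) → (∀ n, 1 ≤ n → sNum T n ≤ t n) →
        ∀ n, 1 ≤ n → sNum ((C + T) ^ k) n ≤ A n ∧ sNum ((C + T) ^ k - C ^ k) n ≤ τ n := by
  have hA1 : (fun n => c (hf n) + t (hf n)) =O[atTop] fun n : ℕ => (n : ℝ) ^ (-α) :=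
    (bigO_hf hα.le hc).add (littleO_hf hα.le ht).isBigO
  have hs1 : ∀ (V : Type u) [NormedAddCommGroup V] [InnerProductSpace ℂ V] (C T : V →L[ℂ] V),
        (∀ n, 1 ≤ n → sNum C n ≤ c n) → (∀ n, 1 ≤ n → sNum T n ≤ t n) →
        ∀ n, 1 ≤ n → sNum (C + T) n ≤ c (hf n) + t (hf n) := by
    intro V _ _ C T hC hT n hn
    exact (sNum_add_le C T (hf_pos hn) (hf_pos hn) (hf_add n)).trans
      (add_le_add (hC _ (hf_pos hn)) (hT _ (hf_pos hn)))
  induction k, hk using Nat.le_induction with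
  | base =>
    refine ⟨fun n => c (hf n) + t (hf n), t, fun n => add_nonneg (hc0 _) (ht0 _), ht0, by simpa using hA1,
      by simpa using ht, ?_⟩
    intro V _ _ C T hC hT n hn
    rw [pow_one, pow_one, add_sub_cancel_left]
    exact ⟨hs1 V C T hC hT n hn, hT n hn⟩
  | succ k hk ih =>
    obtain ⟨A, τ, hA0, hτ0, hA, hτ, hs⟩ := ih
    have hk0 : (0:ℝ) ≤ k * α := by positivity
    have hk1 : (0:ℝ) ≤ k * α + α := by positivity
    have e : ((k + 1 : ℕ) : ℝ) * α = k * α + α := by push_cast; ring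
    rw [e]
    refine ⟨fun n => A (hf n) * (c (hf (hf n)) + t (hf (hf n))),
      fun n => A (hf (hf n)) * t (hf (hf n)) + τ (hf (hf n)) * c (hf (hf n)),
      fun n => mul_nonneg (hA0 _) (add_nonneg (hc0 _) (ht0 _)),
      fun n => add_nonneg (mul_nonneg (hA0 _) (ht0 _)) (mul_nonneg (hτ0 _) (hc0 _)), ?_, ?_, ?_⟩
    · exact ((bigO_hf hk0 hA).mul (bigO_hf hα.le hA1)).trans_eventuallyEq (rpow_mul_ev _ _)
    · have h1 : (fun n => A n * t n + τ n * c n) =o[atTop] fun n : ℕ => (n : ℝ) ^ (-(k * α + α)) :=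
        ((hA.mul_isLittleO ht).add (hτ.mul_isBigO hc)).trans_eventuallyEq (rpow_mul_ev _ _)
      exact littleO_hf hk1 (littleO_hf hk1 h1)
    · intro V _ _ C T hC hT n hn
      have h1 := hf_pos hn
      have h2 := hf_pos h1
      constructor
      · rw [pow_succ]
        refine (sNum_mul_le _ _ h1 h1 (hf_add n)).trans ?_
        exact mul_le_mul (hs V C T hC hT _ h1).1 (hs1 V C T hC hT _ h1) (sNum_nonneg _ _) (hA0 _)
      · have e2 : (C + T) ^ (k + 1) - C ^ (k + 1) = (C + T) ^ k * T + ((C + T) ^ k - C ^ k) * C := by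
          rw [pow_succ, pow_succ]; noncomm_ring
        rw [e2]
        refine (sNum_add_le _ _ h1 h1 (hf_add n)).trans (add_le_add ?_ ?_)
        · refine (sNum_mul_le _ _ h2 h2 (hf_add _)).trans ?_
          exact mul_le_mul (hs V C T hC hT _ h2).1 (hT _ h2) (sNum_nonneg _ _) (hA0 _)
        · refine (sNum_mul_le _ _ h2 h2 (hf_add _)).trans ?_
          exact mul_le_mul (hs V C T hC hT _ h2).2 (hC _ h2) (sNum_nonneg _ _) (hτ0 _)
end powers
end SV

namespace SV
universe u
set_option linter.unusedSectionVars false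
section compress
variable {H : Type u} [NormedAddCommGroup H] [InnerProductSpace ℂ H] [CompleteSpace H]
open ContinuousLinearMap

theorem exists_finrank (X : H →L[ℂ] H) (h : Tendsto (sNum X) atTop (𝓝 0)) {ε : ℝ} (hε : 0 < ε) :
    ∃ F : H →L[ℂ] H, FiniteDimensional ℂ (LinearMap.range (F : H →ₗ[ℂ] H)) ∧ ‖X - F‖ < ε := by
  obtain ⟨n, hn, hn1⟩ := ((h.eventually (gt_mem_nhds hε)).and (eventually_ge_atTop 1)).exists
  obtain ⟨F, hF, hFx⟩ := exists_lt X hn1 hn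
  refine ⟨F, ?_, hFx⟩
  have := hF.trans Cardinal.natCast_lt_aleph0
  exact Module.rank_lt_aleph0_iff.1 this

theorem adj_eq (F : H →L[ℂ] H) (W : Submodule ℂ H) [W.HasOrthogonalProjection]
    (hW : LinearMap.range (F : H →ₗ[ℂ] H) ≤ W) : adjoint F * W.starProjection = adjoint F := by
  have h1 : W.starProjection * F = F := by
    ext x
    exact Submodule.starProjection_eq_self_iff.2 (hW ⟨x, rfl⟩)
  have h2 := congrArg adjoint h1
  rw [← star_eq_adjoint, ← star_eq_adjoint, star_mul, (isSelfAdjoint_starProjection W).star_eq] at h2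
  simpa [star_eq_adjoint] using h2

theorem adj_finrank (F : H →L[ℂ] H) [FiniteDimensional ℂ (LinearMap.range (F : H →ₗ[ℂ] H))] :
    FiniteDimensional ℂ (LinearMap.range ((adjoint F : H →L[ℂ] H) : H →ₗ[ℂ] H)) := by
  set W := LinearMap.range (F : H →ₗ[ℂ] H)
  have : LinearMap.range ((adjoint F : H →L[ℂ] H) : H →ₗ[ℂ] H) ≤
      W.map ((adjoint F : H →L[ℂ] H) : H →ₗ[ℂ] H) := by
    rintro _ ⟨x, rfl⟩
    refine ⟨W.starProjection x, Submodule.starProjection_apply_mem _ _, ?_⟩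
    have := congrArg (fun f : H →L[ℂ] H => f x) (adj_eq F W le_rfl)
    simpa using this
  exact Submodule.finiteDimensional_of_le this

theorem compact_of_finrank (F : H →L[ℂ] H) [FiniteDimensional ℂ (LinearMap.range (F : H →ₗ[ℂ] H))] :
    IsCompactOperator (adjoint F) := by
  set W := LinearMap.range (F : H →ₗ[ℂ] H)
  have h1 : IsCompactOperator (W.orthogonalProjectionOnto) := by
    have : ProperSpace W := FiniteDimensional.proper ℂ W
    refine ⟨Metric.closedBall 0 1, isCompact_closedBall _ _, ?_⟩
    refine W.orthogonalProjectionOnto.continuous.continuousAt.preimage_mem_nhds ?_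
    rw [map_zero]
    exact Metric.closedBall_mem_nhds _ one_pos
  have h2 := h1.clm_comp (adjoint F ∘L W.subtypeL)
  have h3 : ⇑(adjoint F ∘L W.subtypeL) ∘ ⇑W.orthogonalProjectionOnto = ⇑(adjoint F) := by
    ext x
    have := congrArg (fun f : H →L[ℂ] H => f x) (adj_eq F W le_rfl)
    simpa using this
  rwa [h3] at h2

theorem compact_adj (A : H →L[ℂ] H)
    (h : ∀ ε > 0, ∃ F : H →L[ℂ] H, FiniteDimensional ℂ (LinearMap.range (F : H →ₗ[ℂ] H)) ∧ ‖A - F‖ < ε) :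
    IsCompactOperator (adjoint A) := by
  have hc := isClosed_setOfPred_isCompactOperator (σ₁₂ := RingHom.id ℂ) (M₁ := H) (M₂ := H)
  have hm : adjoint A ∈ closure {f : H →L[ℂ] H | IsCompactOperator f} := by
    rw [Metric.mem_closure_iff]
    intro ε hε
    obtain ⟨F, hF, hFx⟩ := h ε hε
    refine ⟨adjoint F, compact_of_finrank F, ?_⟩
    rwa [dist_eq_norm, ← map_sub, LinearIsometryEquiv.norm_map]
  rw [hc.closure_eq] at hm
  exact hm

theorem pow_small (A : H →L[ℂ] H) (hc : IsCompactOperator (adjoint A))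
    (hno : ¬ ∃ μ : ℂ, μ ≠ 0 ∧ Module.End.HasEigenvalue (adjoint A : H →ₗ[ℂ] H) μ)
    {η : ℝ} (hη : 0 < η) : ∃ m : ℕ, 1 ≤ m ∧ ‖A ^ m‖ < η ^ m := by
  have hs : spectralRadius ℂ (adjoint A) = 0 := by
    unfold spectralRadius
    refine le_antisymm (iSup₂_le fun μ hμ => ?_) bot_le
    by_cases h0 : μ = 0
    · simp [h0]
    · rcases IsCompactOperator.hasEigenvalue_or_mem_resolventSet hc h0 with h | h
      · exact absurd ⟨μ, h0, h⟩ hno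
      · exact absurd h hμ
  have ht := spectrum.pow_norm_pow_one_div_tendsto_nhds_spectralRadius (adjoint A)
  rw [hs] at ht
  have h1 : (0 : ENNReal) < ENNReal.ofReal η := by simpa using hη
  obtain ⟨m, hm, hm1⟩ := ((ht.eventually (gt_mem_nhds h1)).and (eventually_ge_atTop 1)).exists
  refine ⟨m, hm1, ?_⟩
  rw [ENNReal.ofReal_lt_ofReal_iff hη] at hm
  have e : ‖(adjoint A) ^ m‖ = ‖A ^ m‖ := by
    rw [← star_eq_adjoint, ← star_pow, norm_star]
  rw [e] at hm
  have hm0 : (m:ℝ) ≠ 0 := by positivity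
  calc ‖A ^ m‖ = (‖A ^ m‖ ^ (1 / (m:ℝ))) ^ m := by
        rw [← Real.rpow_natCast, ← Real.rpow_mul (norm_nonneg _), one_div, inv_mul_cancel₀ hm0, Real.rpow_one]
    _ < η ^ m := pow_lt_pow_left₀ hm (by positivity) (by omega)

theorem compress (A C T : H →L[ℂ] H) (hA : A = C + T) (hCpos : C.IsPositive)
    (hC : Tendsto (sNum C) atTop (𝓝 0)) (hT : Tendsto (sNum T) atTop (𝓝 0))
    (hno : ¬ ∃ μ : ℂ, μ ≠ 0 ∧ Module.End.HasEigenvalue (adjoint A : H →ₗ[ℂ] H) μ)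
    {η : ℝ} (hη : 0 < η) :
    ∃ (V : Type u) (_ : NormedAddCommGroup V) (_ : InnerProductSpace ℂ V) (_ : FiniteDimensional ℂ V)
      (C' T' : V →L[ℂ] V), C'.IsPositive ∧ (∀ n, 1 ≤ n → sNum C' n ≤ sNum C n) ∧
      (∀ n, 1 ≤ n → sNum T' n ≤ sNum T n) ∧ (∀ n, 1 ≤ n → sNum C n ≤ sNum C' n + η) ∧
      ∀ (k : ℕ) (μ : ℂ), Module.End.HasEigenvalue (((C' + T') ^ k : V →L[ℂ] V) : V →ₗ[ℂ] V) μ →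
        ‖μ‖ ≤ η ^ k := by
  have hap : ∀ ε > 0, ∃ F : H →L[ℂ] H, FiniteDimensional ℂ (LinearMap.range (F : H →ₗ[ℂ] H)) ∧ ‖A - F‖ < ε := by
    intro ε hε
    obtain ⟨F, hF, hFx⟩ := exists_finrank C hC (half_pos hε)
    obtain ⟨G, hG, hGx⟩ := exists_finrank T hT (half_pos hε)
    refine ⟨F + G, ?_, ?_⟩
    · have : LinearMap.range ((F + G : H →L[ℂ] H) : H →ₗ[ℂ] H) ≤
          LinearMap.range (F : H →ₗ[ℂ] H) ⊔ LinearMap.range (G : H →ₗ[ℂ] H) := by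
        rintro _ ⟨x, rfl⟩
        exact Submodule.add_mem_sup ⟨x, rfl⟩ ⟨x, rfl⟩
      exact Submodule.finiteDimensional_of_le this
    · have : A - (F + G) = (C - F) + (T - G) := by rw [hA]; abel
      rw [this]
      exact (norm_add_le _ _).trans_lt (by linarith)
  obtain ⟨m, hm1, hm⟩ := pow_small A (compact_adj A hap) hno hη
  obtain ⟨ε, hε, hball⟩ : ∃ ε > 0, ∀ B : H →L[ℂ] H, ‖B - A‖ < ε → ‖B ^ m‖ < η ^ m := by
    have hcont : ContinuousAt (fun B : H →L[ℂ] H => ‖B ^ m‖) A := by fun_prop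
    obtain ⟨ε, hε, h⟩ := Metric.eventually_nhds_iff.1 (hcont.eventually (gt_mem_nhds hm))
    exact ⟨ε, hε, fun B hB => h (by rwa [dist_eq_norm])⟩
  obtain ⟨F, hF, hFx⟩ := hap (ε / 2) (by positivity)
  obtain ⟨F', hF', hFx'⟩ := exists_finrank C hC (half_pos hη)
  have := adj_finrank F
  have := adj_finrank F'
  let V : Submodule ℂ H := (LinearMap.range (F : H →ₗ[ℂ] H) ⊔
    LinearMap.range ((adjoint F : H →L[ℂ] H) : H →ₗ[ℂ] H)) ⊔ (LinearMap.range (F' : H →ₗ[ℂ] H) ⊔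
    LinearMap.range ((adjoint F' : H →L[ℂ] H) : H →ₗ[ℂ] H))
  have : FiniteDimensional ℂ V := inferInstance
  set P : H →L[ℂ] H := V.starProjection with hP
  have hPn : ‖P‖ ≤ 1 := V.starProjection_norm_le
  have hcl : ∀ (X F : H →L[ℂ] H), LinearMap.range (F : H →ₗ[ℂ] H) ≤ V →
      LinearMap.range ((adjoint F : H →L[ℂ] H) : H →ₗ[ℂ] H) ≤ V → ∀ δ : ℝ, ‖X - F‖ < δ / 2 →
      ‖P * X * P - X‖ < δ := by
    intro X F h1 h2 δ hδ
    have e1 : F * P = F := by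
      have := adj_eq (adjoint F) V h2
      rwa [adjoint_adjoint] at this
    have e2 : P * F = F := by
      ext x
      exact Submodule.starProjection_eq_self_iff.2 (h1 ⟨x, rfl⟩)
    have e3 : P * X * P - X = P * (X - F) * P - (X - F) := by
      rw [mul_sub, sub_mul, e2, e1]; abel
    rw [e3]
    have h3 : ‖P * (X - F) * P‖ ≤ ‖X - F‖ := by
      calc _ ≤ ‖P‖ * ‖X - F‖ * ‖P‖ := (norm_mul_le _ _).trans
            (mul_le_mul_of_nonneg_right (norm_mul_le _ _) (norm_nonneg _))
        _ ≤ 1 * ‖X - F‖ * 1 := by gcongr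
        _ = _ := by ring
    have := norm_sub_le (P * (X - F) * P) (X - F)
    linarith
  have hAP := hcl A F (le_sup_left.trans le_sup_left) (le_sup_right.trans le_sup_left) ε hFx
  have hCP := hcl C F' (le_sup_left.trans le_sup_right) (le_sup_right.trans le_sup_right) η hFx'
  have hπ : ‖V.orthogonalProjectionOnto‖ ≤ 1 := V.orthogonalProjectionOnto_norm_le
  have hι : ‖V.subtypeL‖ ≤ 1 := V.norm_subtypeL_le
  have hle : ∀ X : H →L[ℂ] H, ∀ n, 1 ≤ n →
      sNum (V.orthogonalProjectionOnto ∘L X ∘L V.subtypeL) n ≤ sNum X n := by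
    intro X n hn
    refine (sNum_comp3 X _ _ hn).trans ?_
    have := sNum_nonneg X n
    calc _ ≤ 1 * sNum X n * 1 := by gcongr
      _ = _ := by ring
  refine ⟨V, inferInstance, inferInstance, inferInstance,
    V.orthogonalProjectionOnto ∘L C ∘L V.subtypeL, V.orthogonalProjectionOnto ∘L T ∘L V.subtypeL,
    hCpos.orthogonalProjectionOnto_comp V, hle C, hle T, ?_, ?_⟩
  · intro n hn
    have e : P * C * P = V.subtypeL ∘L (V.orthogonalProjectionOnto ∘L C ∘L V.subtypeL) ∘L V.orthogonalProjectionOnto := rfl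
    have h1 : sNum (P * C * P) n ≤ sNum (V.orthogonalProjectionOnto ∘L C ∘L V.subtypeL) n := by
      rw [e]
      refine (sNum_comp3 _ _ _ hn).trans ?_
      have := sNum_nonneg (V.orthogonalProjectionOnto ∘L C ∘L V.subtypeL) n
      calc _ ≤ 1 * sNum (V.orthogonalProjectionOnto ∘L C ∘L V.subtypeL) n * 1 := by gcongr
        _ = _ := by ring
    have h2 := sNum_le_add_norm C (P * C * P) hn
    rw [norm_sub_rev] at h2
    linarith
  · intro k μ hμ
    obtain ⟨x, hx⟩ := hμ.exists_hasEigenvector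
    set B := V.orthogonalProjectionOnto ∘L C ∘L V.subtypeL + V.orthogonalProjectionOnto ∘L T ∘L V.subtypeL with hB
    have hBA : ∀ y : V, (P * A * P) (y : H) = (B y : H) := by
      intro y
      have : P y = y := Submodule.starProjection_eq_self_iff.2 y.2
      rw [mul_apply_eq_comp, mul_apply_eq_comp, this, hA, hB]
      simp [hP]
    have hBk : ∀ (j : ℕ) (y : V), ((P * A * P) ^ j) (y : H) = ((B ^ j) y : H) := by
      intro j
      induction j with
      | zero => intro y; simp
      | succ j ih =>
        intro y
        calc ((P * A * P) ^ (j + 1)) (y : H) = ((P * A * P) ^ j) ((P * A * P) (y : H)) := by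
              rw [pow_succ]; rfl
          _ = ((B ^ (j + 1)) y : H) := by rw [hBA, ih, pow_succ]; rfl
    have hxk : (B ^ k) x = μ • x := hx.apply_eq_smul
    have hxm : ∀ j : ℕ, ((B ^ k) ^ j) x = μ ^ j • x := by
      intro j
      induction j with
      | zero => simp
      | succ j ih => rw [pow_succ, mul_apply_eq_comp, hxk, map_smul, ih, smul_smul, pow_succ, mul_comm]
    have hx0 : 0 < ‖x‖ := norm_pos_iff.2 hx.2
    have h1 : ‖μ‖ ^ m * ‖x‖ ≤ (η ^ k) ^ m * ‖x‖ := by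
      calc ‖μ‖ ^ m * ‖x‖ = ‖μ ^ m • x‖ := by rw [norm_smul, norm_pow]
        _ = ‖((P * A * P) ^ (k * m)) (x : H)‖ := by
          rw [hBk, ← hxm, pow_mul]; rfl
        _ ≤ ‖((P * A * P) ^ m) ^ k‖ * ‖(x : H)‖ := by
          rw [← pow_mul, mul_comm m k]; exact le_opNorm _ _
        _ ≤ (η ^ m) ^ k * ‖x‖ := by
          refine mul_le_mul_of_nonneg_right ?_ (norm_nonneg _)
          rcases Nat.eq_zero_or_pos k with rfl | hk
          · rw [pow_zero, pow_zero]; exact ContinuousLinearMap.norm_id_le (𝕜 := ℂ) (E := H)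
          · exact (norm_pow_le' _ hk).trans (pow_le_pow_left₀ (norm_nonneg _) (hball _ hAP).le _)
        _ = _ := by rw [← pow_mul, ← pow_mul, mul_comm m k]
    have h2 := le_of_mul_le_mul_right h1 hx0
    exact le_of_pow_le_pow_left₀ (by omega) (by positivity) h2
end compress
end SV

namespace SV
section fd
open Module

theorem rot_lower (θ y : ℝ) : Real.sin θ ≤ ‖1 + -Complex.exp (θ * Complex.I) * (y : ℂ)‖ := by
  have h1 : ‖Complex.exp ((-θ : ℝ) * Complex.I) * (1 + -Complex.exp (θ * Complex.I) * (y : ℂ))‖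
      = ‖1 + -Complex.exp (θ * Complex.I) * (y : ℂ)‖ := by
    rw [norm_mul, Complex.norm_exp_ofReal_mul_I, one_mul]
  have h2 : Complex.exp ((-θ : ℝ) * Complex.I) * (1 + -Complex.exp (θ * Complex.I) * (y : ℂ))
      = Complex.exp ((-θ : ℝ) * Complex.I) - y := by
    have : Complex.exp ((-θ : ℝ) * Complex.I) * Complex.exp (θ * Complex.I) = 1 := by
      rw [← Complex.exp_add]; simp
    linear_combination (-(y:ℂ)) * this
  rw [← h1, h2]
  refine le_trans ?_ (Complex.abs_im_le_norm _)
  rw [Complex.sub_im, Complex.exp_ofReal_mul_I_im, Complex.ofReal_im, Real.sin_neg, sub_zero, abs_neg]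
  exact le_abs_self _

theorem rot_slit {θ : ℝ} (h0 : 0 < θ) (h1 : θ < Real.pi) (l : ℂ) (h : θ ≠ -l.arg) :
    -Complex.exp (θ * Complex.I) * l ∈ Complex.slitPlane ∨ -Complex.exp (θ * Complex.I) * l = 0 := by
  by_cases hl : l = 0
  · right; simp [hl]
  left
  have hn : 0 < ‖l‖ := norm_pos_iff.2 hl
  have e : -Complex.exp (θ * Complex.I) * l
      = ((‖l‖ : ℝ) : ℂ) * -Complex.exp ((θ + l.arg : ℝ) * Complex.I) := by
    conv_lhs => rw [← Complex.norm_mul_exp_arg_mul_I l]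
    push_cast
    rw [add_mul, Complex.exp_add]; ring
  rw [e, Complex.mem_slitPlane_iff]
  rw [Complex.re_ofReal_mul, Complex.im_ofReal_mul, Complex.neg_re, Complex.neg_im,
    Complex.exp_ofReal_mul_I_re, Complex.exp_ofReal_mul_I_im]
  by_cases hs : Real.sin (θ + l.arg) = 0
  · left
    have a1 := Complex.neg_pi_lt_arg l
    have a2 := Complex.arg_le_pi l
    have : θ + l.arg = Real.pi := by
      by_contra hne
      rcases lt_trichotomy (θ + l.arg) 0 with h3 | h3 | h3
      · exact absurd hs (Real.sin_neg_of_neg_of_neg_pi_lt h3 (by linarith)).ne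
      · exact h (by linarith)
      · rcases lt_or_gt_of_ne hne with h4 | h4
        · exact absurd hs (Real.sin_pos_of_pos_of_lt_pi h3 h4).ne'
        · have := Real.sin_pos_of_pos_of_lt_pi (x := θ + l.arg - Real.pi) (by linarith) (by linarith)
          rw [Real.sin_sub_pi] at this
          linarith
    rw [this, Real.cos_pi]; simpa using hn
  · right
    exact mul_ne_zero hn.ne' (neg_ne_zero.2 hs)

theorem rot_cpow {θ y s : ℝ} (h0 : 0 < θ) (h1 : θ < Real.pi) (hs : 0 < s) (hy : 0 ≤ y) :
    ((-Complex.exp (θ * Complex.I) * (y : ℂ)) ^ (s : ℂ)).re = y ^ s * Real.cos ((Real.pi - θ) * s) := by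
  rcases hy.eq_or_lt with h | h
  · subst h
    rw [Complex.cpow_ofReal_re]; simp [Real.zero_rpow hs.ne']
  have e : -Complex.exp (θ * Complex.I) * (y : ℂ) = (y : ℂ) * Complex.exp ((θ - Real.pi : ℝ) * Complex.I) := by
    push_cast
    rw [sub_mul, Complex.exp_sub, Complex.exp_pi_mul_I]; ring
  have harg : (Complex.exp ((θ - Real.pi : ℝ) * Complex.I)).arg = θ - Real.pi := by
    rw [Complex.exp_mul_I]
    have := Complex.arg_mul_cos_add_sin_mul_I (r := 1) one_pos (θ := θ - Real.pi)
      ⟨by linarith, by linarith⟩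
    simpa using this
  rw [Complex.cpow_ofReal_re, e, norm_mul, Complex.norm_exp_ofReal_mul_I, mul_one, Complex.norm_real,
    Real.norm_of_nonneg hy, Complex.arg_real_mul _ h, harg, ← Real.cos_neg]
  congr 2; ring

variable {V : Type*} [NormedAddCommGroup V] [InnerProductSpace ℂ V] [FiniteDimensional ℂ V]

theorem pos_pow (C : V →L[ℂ] V) (hC : C.IsPositive) (k : ℕ) : (C ^ k).IsPositive := by
  have : CompleteSpace V := FiniteDimensional.complete ℂ V
  rw [← ContinuousLinearMap.nonneg_iff_isPositive] at hC ⊢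
  exact CStarAlgebra.pow_nonneg hC k

theorem pow_eig (C : V →L[ℂ] V) (x : V) (c : ℝ) (h : C x = (c : ℂ) • x) (k : ℕ) :
    (C ^ k) x = ((c ^ k : ℝ) : ℂ) • x := by
  induction k with
  | zero => simp
  | succ k ih =>
    rw [pow_succ, mul_apply_eq_comp, h, map_smul, ih, smul_smul]
    congr 1; push_cast; ring

theorem eig_pack (B : V →L[ℂ] V) : ∃ (m : ℕ) (l : Fin m → ℂ),
    (∀ w : ℂ, (1 + w • B).det = ∏ i, (1 + w * l i)) ∧
    (∀ i, Module.End.HasEigenvalue (B : V →ₗ[ℂ] V) (l i)) ∧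
    (LinearMap.trace ℂ V (B : V →ₗ[ℂ] V) = ∑ i, l i) ∧
    (∀ v : ℝ, 0 < v → v < 1 → ∑ i, ‖l i‖ ^ v ≤
      g v / L v * ∑ j : Fin (finrank ℂ V), sNum B (j + 1) ^ v) := by
  obtain ⟨m, l, h1, h2, h3⟩ := exists_eig B
  refine ⟨m, l, h1, h2, h3, fun v h0 hv => ?_⟩
  refine weyl l (fun j : Fin (finrank ℂ V) => sNum B (j + 1)) (fun j => sNum_nonneg _ _) (fun z => ?_) h0 hv
  have := det_one_add_le B z
  rwa [h1, norm_prod] at this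

theorem fd_ineq (C T : V →L[ℂ] V) (hC : C.IsPositive) (k : ℕ) {ρ θ₀ : ℝ}
    (hρ : 0 < ρ) (hθ0 : 0 < θ₀) (hθ1 : θ₀ < Real.pi / 2)
    (hρθ : Real.pi / 2 < (Real.pi - θ₀) * ρ) :
    ∃ (m : ℕ) (l : Fin m → ℂ),
    (∀ i, Module.End.HasEigenvalue (((C + T) ^ k : V →L[ℂ] V) : V →ₗ[ℂ] V) (l i)) ∧
    (∀ v : ℝ, 0 < v → v < 1 → ∑ i, ‖l i‖ ^ v ≤
      g v / L v * ∑ j : Fin (finrank ℂ V), sNum ((C + T) ^ k) (j + 1) ^ v) ∧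
    ∀ s : ℝ, ρ < s → s < 1 →
      (-Real.cos ((Real.pi - θ₀) * ρ)) * ∑ j : Fin (finrank ℂ V), (sNum C (j + 1) ^ k) ^ s ≤
      ∑ i, ‖l i‖ ^ s +
        ∑ j : Fin (finrank ℂ V), (sNum ((C + T) ^ k - C ^ k) (j + 1) / Real.sin (θ₀ / 2)) ^ s := by
  obtain ⟨m, l, h1, h2, -, h4⟩ := eig_pack ((C + T) ^ k)
  refine ⟨m, l, h2, h4, fun s hs hs1 => ?_⟩
  obtain ⟨b, c, hc0, hc1, hc2⟩ := exists_pos_eig C hC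
  have hpi := Real.pi_pos
  obtain ⟨θ, hθ, hθl⟩ : ∃ θ ∈ Set.Ioo (θ₀ / 2) θ₀, θ ∉ Set.range (fun i => -(l i).arg) := by
    by_contra hcon
    push Not at hcon
    exact Set.Ioo_infinite (show θ₀ / 2 < θ₀ by linarith) ((Set.finite_range _).subset hcon)
  obtain ⟨ha, hb⟩ := hθ
  set ζ : ℂ := -Complex.exp (θ * Complex.I) with hζ
  have hζn : ‖ζ‖ = 1 := by rw [hζ, norm_neg, Complex.norm_exp_ofReal_mul_I]
  have hδ : 0 < Real.sin θ := Real.sin_pos_of_pos_of_lt_pi (by linarith) (by linarith)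
  have hδ0 : 0 < Real.sin (θ₀ / 2) := Real.sin_pos_of_pos_of_lt_pi (by linarith) (by linarith)
  have hδδ : Real.sin (θ₀ / 2) ≤ Real.sin θ :=
    Real.sin_le_sin_of_le_of_le_pi_div_two (by linarith) (by linarith) ha.le
  have hs0 : 0 < s := hρ.trans hs
  set R := (C + T) ^ k - C ^ k with hR
  have key := mellin_ineq (fun i => ζ * l i)
    (Sum.elim (fun i => ζ * ((c i ^ k : ℝ) : ℂ))
      (fun j : Fin (finrank ℂ V) => ((sNum R (j + 1) / Real.sin θ : ℝ) : ℂ)))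
    (fun i => rot_slit (by linarith) (by linarith) _ (fun h => hθl ⟨i, h.symm⟩)) ?_ ?_ hs0 hs1
  · rw [Fintype.sum_sum_type] at key
    simp only [Sum.elim_inl, Sum.elim_inr] at key
    have e1 : ∀ i, -‖l i‖ ^ s ≤ ((ζ * l i) ^ (s : ℂ)).re := by
      intro i
      have := (abs_le.1 (Complex.abs_re_le_norm ((ζ * l i) ^ (s : ℂ)))).1
      rwa [Complex.norm_cpow_real, norm_mul, hζn, one_mul] at this
    have hcos : Real.cos ((Real.pi - θ) * s) ≤ Real.cos ((Real.pi - θ₀) * ρ) := by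
      refine Real.cos_le_cos_of_nonneg_of_le_pi (by linarith) ?_ ?_
      · nlinarith
      · exact mul_le_mul (by linarith) hs.le hρ.le (by linarith)
    have hκ : Real.cos ((Real.pi - θ₀) * ρ) ≤ 0 := by
      refine Real.cos_nonpos_of_pi_div_two_le_of_le hρθ.le ?_
      nlinarith
    have e2 : ∀ i, ((ζ * ((c i ^ k : ℝ) : ℂ)) ^ (s : ℂ)).re ≤
        (sNum C (i + 1) ^ k) ^ s * Real.cos ((Real.pi - θ₀) * ρ) := by
      intro i
      rw [hζ, rot_cpow (by linarith) (by linarith) hs0 (pow_nonneg (hc0 i) k)]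
      have h5 : (sNum C (i + 1) ^ k) ^ s ≤ (c i ^ k) ^ s :=
        Real.rpow_le_rpow (pow_nonneg (sNum_nonneg _ _) _)
          (pow_le_pow_left₀ (sNum_nonneg _ _) (hc2 i) k) hs0.le
      have h6 : 0 ≤ (c i ^ k) ^ s := Real.rpow_nonneg (pow_nonneg (hc0 i) k) _
      nlinarith
    have e3 : ∀ j : Fin (finrank ℂ V), ((((sNum R (j + 1) / Real.sin θ : ℝ) : ℂ)) ^ (s : ℂ)).re ≤
        (sNum R (j + 1) / Real.sin (θ₀ / 2)) ^ s := by
      intro j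
      have := sNum_nonneg R (j + 1)
      rw [← Complex.ofReal_cpow (by positivity), Complex.ofReal_re]
      refine Real.rpow_le_rpow (by positivity) ?_ hs0.le
      exact div_le_div_of_nonneg_left this hδ0 hδδ
    have t1 := Finset.sum_le_sum (s := Finset.univ) fun i _ => e1 i
    have t2 := Finset.sum_le_sum (s := Finset.univ) fun i _ => e2 i
    have t3 := Finset.sum_le_sum (s := Finset.univ) fun i _ => e3 i
    rw [Finset.sum_neg_distrib] at t1
    rw [← Finset.sum_mul] at t2
    linarith
  · rintro (i | j)
    · refine rot_slit (by linarith) (by linarith) _ fun h => ?_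
      rw [Complex.arg_ofReal_of_nonneg (pow_nonneg (hc0 i) k)] at h
      linarith
    · exact slit_nonneg (div_nonneg (sNum_nonneg _ _) hδ.le)
  · intro x hx
    have hd := det_ineq (C ^ k) R (pos_pow C hC k) ((x : ℂ) * ζ) (Real.sin θ) hδ ?_
    · rw [hR, add_sub_cancel, h1, norm_prod, det_diag (1 + ((x : ℂ) * ζ) • C ^ k) b
        (fun i => 1 + (x : ℂ) * ζ * ((c i ^ k : ℝ) : ℂ)) ?_, norm_prod] at hd
      · rw [Fintype.prod_sum_type]
        simp only [Sum.elim_inl, Sum.elim_inr]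
        convert hd using 2
        · congr 1; ring
        · refine Finset.prod_congr rfl fun i _ => ?_
          congr 1; ring
        · refine Finset.prod_congr rfl fun j _ => ?_
          have h7 := sNum_nonneg R (j + 1)
          rw [norm_mul, hζn, Complex.norm_real, Real.norm_of_nonneg hx.le, ← Complex.ofReal_mul,
            ← Complex.ofReal_one, ← Complex.ofReal_add, Complex.norm_real, Real.norm_of_nonneg (by positivity)]
          rw [hR]; ring
      · intro i
        rw [add_apply, one_apply_eq_self, smul_apply, pow_eig C _ _ (hc1 i) k]
        module
    · intro y hy
      have := rot_lower θ (x * y)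
      rw [← hζ] at this
      refine this.trans (le_of_eq ?_)
      congr 1; push_cast; ring

end fd
end SV

namespace SV
universe u
section lim
open Module

theorem summable_of_O {A : ℕ → ℝ} {β v : ℝ}
    (hA : A =O[atTop] fun n : ℕ => (n:ℝ) ^ (-β)) (hv : 0 < v) (hβ : 1 < β * v) :
    Summable fun j : ℕ => A (j + 1) ^ v := by
  have h1 := hA.rpow hv.le (Eventually.of_forall fun n => Real.rpow_nonneg (Nat.cast_nonneg n) _)
  have h2 : Summable fun n : ℕ => A n ^ v := by
    refine summable_of_isBigO_nat (g := fun n : ℕ => (n:ℝ) ^ (-(β * v))) (Real.summable_nat_rpow.2 (by linarith)) ?_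
    refine h1.congr (fun n => rfl) (fun n => ?_)
    change ((n:ℝ) ^ (-β)) ^ v = _
    rw [← Real.rpow_mul (Nat.cast_nonneg n)]; congr 1; ring
  exact (summable_nat_add_iff (f := fun n : ℕ => A n ^ v) 1).2 h2

theorem sum_fin_le {f F : ℕ → ℝ} (hF0 : ∀ j, 0 ≤ F j) (hF : Summable F) (hf : ∀ j, f j ≤ F j) (d : ℕ) :
    ∑ j : Fin d, f j ≤ ∑' j, F j := by
  rw [Fin.sum_univ_eq_sum_range]
  exact (Finset.sum_le_sum fun j _ => hf j).trans (hF.sum_le_tsum _ fun j _ => hF0 j)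

theorem le_sum_fin {f F : ℕ → ℝ} {d : ℕ} (hF0 : ∀ j, 0 ≤ F j) (hF : ∀ j, d ≤ j → F j = 0) (hf : ∀ j, f j ≤ F j)
    (N : ℕ) : ∑ j ∈ Finset.range N, f j ≤ ∑ j : Fin d, F j := by
  rw [Fin.sum_univ_eq_sum_range]
  refine (Finset.sum_le_sum fun j _ => hf j).trans ?_
  refine (Finset.sum_le_sum_of_subset_of_nonneg (Finset.range_mono (le_max_left N d)) fun j _ _ => hF0 j).trans ?_
  refine (Finset.sum_subset (Finset.range_mono (le_max_right N d)) fun j _ hj => hF j ?_).ge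
  simpa using hj

variable {H : Type u} [NormedAddCommGroup H] [InnerProductSpace ℂ H] [CompleteSpace H]

theorem lim_ineq (A C T : H →L[ℂ] H) (hA : A = C + T) (hCpos : C.IsPositive)
    (hC0 : Tendsto (sNum C) atTop (𝓝 0)) (hT0 : Tendsto (sNum T) atTop (𝓝 0))
    (hno : ¬∃ μ : ℂ, μ ≠ 0 ∧ Module.End.HasEigenvalue (ContinuousLinearMap.adjoint A : H →ₗ[ℂ] H) μ)
    {α : ℝ} (hα : 0 < α) (hC : (sNum C) =O[atTop] fun n : ℕ => (n:ℝ) ^ (-α))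
    (hT : (sNum T) =o[atTop] fun n : ℕ => (n:ℝ) ^ (-α)) (k : ℕ) (hk : 1 ≤ k) {ρ θ₀ : ℝ}
    (hρ : 0 < ρ) (hρα : k * α * ρ = 1) (hθ0 : 0 < θ₀) (hθ1 : θ₀ < Real.pi / 2)
    (hρθ : Real.pi / 2 < (Real.pi - θ₀) * ρ) :
    ∃ τ : ℕ → ℝ, (∀ n, 0 ≤ τ n) ∧ (τ =o[atTop] fun n : ℕ => (n:ℝ) ^ (-(k * α))) ∧
    ∀ s : ℝ, ρ < s → s < 1 → ∀ N : ℕ,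
      (-Real.cos ((Real.pi - θ₀) * ρ)) * ∑ j ∈ Finset.range N, (sNum C (j + 1) ^ k) ^ s ≤
        1 / Real.sin (θ₀ / 2) * ∑' j : ℕ, τ (j + 1) ^ s := by
  have hpi := Real.pi_pos
  obtain ⟨B, τ, hB0, hτ0, hB, hτ, hall⟩ := powers.{u} hα (sNum C) (sNum T) (sNum_nonneg C)
    (sNum_nonneg T) hC hT k hk
  refine ⟨τ, hτ0, hτ, fun s hs hs1 N => ?_⟩
  have hs0 : 0 < s := hρ.trans hs
  set v := (ρ + s) / 2 with hv
  have hv1 : ρ < v := by linarith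
  have hv2 : v < s := by linarith
  have hkα : 0 < k * α := mul_pos (by exact_mod_cast hk) hα
  have hSB : Summable fun j : ℕ => B (j + 1) ^ v :=
    summable_of_O hB (by linarith) (by nlinarith)
  have hSτ : Summable fun j : ℕ => τ (j + 1) ^ s :=
    summable_of_O hτ.isBigO (by linarith) (by nlinarith)
  have hδ0 : 0 < Real.sin (θ₀ / 2) := Real.sin_pos_of_pos_of_lt_pi (by linarith) (by linarith)
  have hκ : 0 ≤ -Real.cos ((Real.pi - θ₀) * ρ) := by
    have := Real.cos_nonpos_of_pi_div_two_le_of_le hρθ.le (by nlinarith)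
    linarith
  set κ := -Real.cos ((Real.pi - θ₀) * ρ)
  set M := g v / L v * ∑' j : ℕ, B (j + 1) ^ v with hM
  have hgL : 0 ≤ g v / L v := (div_pos (g_pos (by linarith) (by linarith)) (L_pos (by linarith) (by linarith))).le
  have main : ∀ η : ℝ, 0 < η →
      κ * ∑ j ∈ Finset.range N, ((max (sNum C (j + 1) - η) 0) ^ k) ^ s ≤
        (η ^ k) ^ (s - v) * M + 1 / Real.sin (θ₀ / 2) * ∑' j : ℕ, τ (j + 1) ^ s := by
    intro η hη
    obtain ⟨V, _, _, _, C', T', hC', h1, h2, h3, h4⟩ := compress A C T hA hCpos hC0 hT0 hno hη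
    obtain ⟨m, l, e1, e2, e3⟩ := fd_ineq C' T' hC' k hρ hθ0 hθ1 hρθ
    have hV := hall V C' T' h1 h2
    refine le_trans ?_ ((e3 s hs hs1).trans (add_le_add ?_ ?_))
    · refine mul_le_mul_of_nonneg_left ?_ hκ
      refine le_sum_fin (F := fun j => (sNum C' (j + 1) ^ k) ^ s) ?_ ?_ ?_ N
      · exact fun j => Real.rpow_nonneg (pow_nonneg (sNum_nonneg _ _) _) _
      · intro j hj
        change (sNum C' (j + 1) ^ k) ^ s = 0
        rw [sNum_eq_zero C' hj, zero_pow (by omega), Real.zero_rpow hs0.ne']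
      · intro j
        refine Real.rpow_le_rpow (by positivity) (pow_le_pow_left₀ (le_max_right _ _) ?_ k) hs0.le
        exact max_le (by linarith [h3 (j + 1) (by omega)]) (sNum_nonneg _ _)
    · have : ∀ i, ‖l i‖ ^ s ≤ (η ^ k) ^ (s - v) * ‖l i‖ ^ v := by
        intro i
        have h5 := h4 k (l i) (e1 i)
        have h6 : ‖l i‖ ^ s = ‖l i‖ ^ (s - v) * ‖l i‖ ^ v := by
          rw [← Real.rpow_add_of_nonneg (norm_nonneg _) (by linarith) (by linarith)]; congr 1; ring
        rw [h6]
        exact mul_le_mul_of_nonneg_right (Real.rpow_le_rpow (norm_nonneg _) h5 (by linarith))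
          (Real.rpow_nonneg (norm_nonneg _) _)
      refine (Finset.sum_le_sum fun i _ => this i).trans ?_
      rw [← Finset.mul_sum]
      refine mul_le_mul_of_nonneg_left ?_ (Real.rpow_nonneg (pow_nonneg hη.le _) _)
      refine (e2 v (by linarith) (by linarith)).trans ?_
      refine mul_le_mul_of_nonneg_left ?_ hgL
      refine sum_fin_le (f := fun j => sNum ((C' + T') ^ k) (j + 1) ^ v)
        (fun j => Real.rpow_nonneg (hB0 _) _) hSB (fun j => ?_) _
      exact Real.rpow_le_rpow (sNum_nonneg _ _) (hV (j + 1) (by omega)).1 (by linarith)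
    · rw [← tsum_mul_left]
      refine sum_fin_le (f := fun j => (sNum ((C' + T') ^ k - C' ^ k) (j + 1) / Real.sin (θ₀ / 2)) ^ s)
        (fun j => ?_) (hSτ.mul_left _) (fun j => ?_) _
      · have := Real.rpow_nonneg (hτ0 (j + 1)) s
        positivity
      · rw [Real.div_rpow (sNum_nonneg _ _) hδ0.le, div_eq_inv_mul, one_div]
        refine mul_le_mul ?_ (Real.rpow_le_rpow (sNum_nonneg _ _) (hV (j + 1) (by omega)).2 hs0.le)
          (Real.rpow_nonneg (sNum_nonneg _ _) _) (by positivity)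
        refine inv_anti₀ hδ0 ?_
        have := Real.rpow_le_rpow_of_exponent_ge hδ0 (Real.sin_le_one _) hs1.le
        rwa [Real.rpow_one] at this
  have lhs : Tendsto (fun η : ℝ => κ * ∑ j ∈ Finset.range N, ((max (sNum C (j + 1) - η) 0) ^ k) ^ s)
      (𝓝[>] 0) (𝓝 (κ * ∑ j ∈ Finset.range N, (sNum C (j + 1) ^ k) ^ s)) := by
    have hcont : Continuous (fun η : ℝ => κ * ∑ j ∈ Finset.range N, ((max (sNum C (j + 1) - η) 0) ^ k) ^ s) := by
      refine continuous_const.mul (continuous_finsetSum _ fun j _ => ?_)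
      exact Continuous.rpow_const (by fun_prop) (fun _ => Or.inr hs0.le)
    have := (hcont.tendsto 0).mono_left (nhdsWithin_le_nhds (s := Set.Ioi 0))
    simpa [max_eq_left (sNum_nonneg C _)] using this
  have rhs : Tendsto (fun η : ℝ => (η ^ k) ^ (s - v) * M + 1 / Real.sin (θ₀ / 2) * ∑' j : ℕ, τ (j + 1) ^ s)
      (𝓝[>] 0) (𝓝 (1 / Real.sin (θ₀ / 2) * ∑' j : ℕ, τ (j + 1) ^ s)) := by
    have hcont : Continuous (fun η : ℝ => (η ^ k) ^ (s - v) * M + 1 / Real.sin (θ₀ / 2) * ∑' j : ℕ, τ (j + 1) ^ s) := by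
      refine Continuous.add (Continuous.mul ?_ continuous_const) continuous_const
      exact Continuous.rpow_const (by fun_prop) (fun _ => Or.inr (by linarith))
    have := (hcont.tendsto 0).mono_left (nhdsWithin_le_nhds (s := Set.Ioi 0))
    simpa [zero_pow (show k ≠ 0 by omega), Real.zero_rpow (show s - v ≠ 0 by linarith)] using this
  exact le_of_tendsto_of_tendsto lhs rhs (eventually_nhdsWithin_of_forall fun η hη => main η hη)

end lim

section contra

theorem contra {β ρ κ K b : ℝ} {a τ : ℕ → ℝ} (hβ : 0 < β) (hρ : 0 < ρ) (hρ1 : ρ < 1) (hβρ : β * ρ = 1) (hκ : 0 < κ)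
    (hK : 0 < K) (hb0 : 0 < b) (hb1 : b ≤ 1) (ha0 : ∀ i, 0 ≤ a i) (hτ0 : ∀ i, 0 ≤ τ i)
    (ha : ∀ᶠ i : ℕ in atTop, b * ((i:ℝ) + 1) ^ (-β) ≤ a i)
    (hτ : ∀ ε > 0, ∀ᶠ i : ℕ in atTop, τ i ≤ ε * ((i:ℝ) + 1) ^ (-β))
    (h : ∀ s, ρ < s → s < 1 → ∀ N : ℕ, κ * ∑ j ∈ Finset.range N, a j ^ s ≤ K * ∑' j : ℕ, τ j ^ s) : False := by
  obtain ⟨ε, hε0, hε1, hε⟩ : ∃ ε : ℝ, 0 < ε ∧ ε ≤ 1 ∧ K * ε ^ ρ ≤ κ * b / 2 := by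
    refine ⟨min 1 ((κ * b / 2 / K) ^ (1 / ρ)), by positivity, min_le_left _ _, ?_⟩
    have : (min 1 ((κ * b / 2 / K) ^ (1 / ρ))) ^ ρ ≤ ((κ * b / 2 / K) ^ (1 / ρ)) ^ ρ :=
      Real.rpow_le_rpow (by positivity) (min_le_right _ _) hρ.le
    rw [← Real.rpow_mul (by positivity), one_div_mul_cancel hρ.ne', Real.rpow_one] at this
    calc _ ≤ K * (κ * b / 2 / K) := mul_le_mul_of_nonneg_left this hK.le
      _ = _ := by field_simp
  obtain ⟨J, hJ⟩ := eventually_atTop.1 (ha.and (hτ ε hε0))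
  set x : ℕ → ℝ := fun j => ((j:ℝ) + 1) ^ (-β) with hx
  have hx0 : ∀ j, 0 < x j := fun j => Real.rpow_pos_of_pos (by positivity) _
  have hx1 : ∀ j, x j ≤ 1 := fun j =>
    Real.rpow_le_one_of_one_le_of_nonpos (by linarith [(Nat.cast_nonneg j : (0:ℝ) ≤ j)]) (by linarith)
  set D := κ * J + K * ∑ j ∈ Finset.range J, (1 + τ j) with hD
  have step : ∀ s, ρ < s → s < 1 → ∀ N : ℕ, κ * b / 2 * ∑ j ∈ Finset.range N, x j ^ s ≤ D := by
    intro s hs hs1 N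
    have hs0 : 0 < s := hρ.trans hs
    have hxs : Summable fun j => x j ^ s := by
      have := summable_of_O (A := fun n : ℕ => (n:ℝ) ^ (-β)) (Asymptotics.isBigO_refl _ _) hs0 (by nlinarith : 1 < β * s)
      simpa [hx] using this
    have hxs0 : ∀ j, 0 ≤ x j ^ s := fun j => Real.rpow_nonneg (hx0 j).le _
    have e1 : ∀ j, b * x j ^ s - (if j < J then 1 else 0) ≤ a j ^ s := by
      intro j
      split_ifs with hj
      · have h1 := Real.rpow_le_one (hx0 j).le (hx1 j) hs0.le
        have h2 := Real.rpow_nonneg (ha0 j) s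
        nlinarith [hxs0 j]
      · rw [sub_zero]
        have h1 := Real.rpow_le_rpow (by have := hx0 j; positivity) (hJ j (by omega)).1 hs0.le
        rw [Real.mul_rpow hb0.le (hx0 j).le] at h1
        have h2 : b ≤ b ^ s := by
          simpa using Real.rpow_le_rpow_of_exponent_ge hb0 hb1 hs1.le
        nlinarith [hxs0 j]
    have e2 : ∀ j, τ j ^ s ≤ ε ^ ρ * x j ^ s + (if j < J then 1 + τ j else 0) := by
      intro j
      have hε2 : 0 < ε ^ ρ := Real.rpow_pos_of_pos hε0 _
      split_ifs with hj
      · have h1 : τ j ^ s ≤ (1 + τ j) ^ s := Real.rpow_le_rpow (hτ0 j) (by linarith) hs0.le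
        have h2 : (1 + τ j) ^ s ≤ (1 + τ j) ^ (1:ℝ) :=
          Real.rpow_le_rpow_of_exponent_le (by linarith [hτ0 j]) hs1.le
        rw [Real.rpow_one] at h2
        have := mul_nonneg hε2.le (hxs0 j)
        linarith
      · rw [add_zero]
        have h1 := Real.rpow_le_rpow (hτ0 j) (hJ j (by omega)).2 hs0.le
        rw [Real.mul_rpow hε0.le (hx0 j).le] at h1
        have h2 : ε ^ s ≤ ε ^ ρ := Real.rpow_le_rpow_of_exponent_ge hε0 hε1 hs.le
        nlinarith [hxs0 j]
    have hfin : ∀ f : ℕ → ℝ, Summable fun j => if j < J then f j else 0 := fun f =>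
      summable_of_ne_finset_zero (s := Finset.range J) fun j hj => by
        simp only [Finset.mem_range] at hj; simp [hj]
    have htau : ∑' j, τ j ^ s ≤ ε ^ ρ * ∑' j, x j ^ s + ∑ j ∈ Finset.range J, (1 + τ j) := by
      have hsum : Summable fun j => ε ^ ρ * x j ^ s + (if j < J then 1 + τ j else 0) :=
        (hxs.mul_left _).add (hfin _)
      have h1 : Summable fun j => τ j ^ s :=
        Summable.of_nonneg_of_le (fun j => Real.rpow_nonneg (hτ0 j) _) e2 hsum
      refine (h1.tsum_le_tsum e2 hsum).trans ?_
      rw [(hxs.mul_left _).tsum_add (hfin _), tsum_mul_left]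
      have hfs : (∑' j, if j < J then 1 + τ j else 0) = ∑ j ∈ Finset.range J, if j < J then 1 + τ j else 0 :=
        tsum_eq_sum fun j hj => by
          simp only [Finset.mem_range] at hj; simp [hj]
      rw [hfs]
      refine add_le_add le_rfl (le_of_eq (Finset.sum_congr rfl fun j hj => ?_))
      simp [Finset.mem_range.1 hj]
    have hpart : ∀ N, κ * (b * ∑ j ∈ Finset.range N, x j ^ s - J) ≤ K * ∑' j, τ j ^ s := by
      intro N
      refine le_trans (mul_le_mul_of_nonneg_left ?_ hκ.le) (h s hs hs1 N)
      refine le_trans ?_ (Finset.sum_le_sum fun j _ => e1 j)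
      rw [Finset.sum_sub_distrib, Finset.mul_sum]
      refine sub_le_sub le_rfl ?_
      rw [Finset.sum_ite, Finset.sum_const_zero, add_zero, Finset.sum_const, nsmul_one]
      have : (Finset.filter (fun j => j < J) (Finset.range N)) ⊆ Finset.range J := by
        intro j hj; simp at hj ⊢; exact hj.2
      exact_mod_cast (Finset.card_le_card this).trans (Finset.card_range J).le
    have hlim : κ * (b * ∑' j, x j ^ s - J) ≤ K * ∑' j, τ j ^ s := by
      refine le_of_tendsto' (((hxs.hasSum.tendsto_sum_nat.const_mul b).sub_const (J:ℝ)).const_mul κ) hpart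
    have hX0 : 0 ≤ ∑' j, x j ^ s := tsum_nonneg hxs0
    have h5 : K * ∑' j, τ j ^ s ≤ K * (ε ^ ρ * ∑' j, x j ^ s + ∑ j ∈ Finset.range J, (1 + τ j)) :=
      mul_le_mul_of_nonneg_left htau hK.le
    have h6 : K * ε ^ ρ * ∑' j, x j ^ s ≤ κ * b / 2 * ∑' j, x j ^ s := mul_le_mul_of_nonneg_right hε hX0
    have h7 : ∑ j ∈ Finset.range N, x j ^ s ≤ ∑' j, x j ^ s := hxs.sum_le_tsum _ fun j _ => hxs0 j
    have h8 := mul_le_mul_of_nonneg_left h7 (show 0 ≤ κ * b / 2 by positivity)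
    rw [hD]
    linarith
  have step2 : ∀ N : ℕ, κ * b / 2 * ∑ j ∈ Finset.range N, 1 / ((j:ℝ) + 1) ≤ D := by
    intro N
    have hcont : Continuous (fun s : ℝ => κ * b / 2 * ∑ j ∈ Finset.range N, x j ^ s) := by
      refine continuous_const.mul (continuous_finsetSum _ fun j _ => ?_)
      exact Real.continuous_const_rpow (hx0 j).ne'
    have h1 := (hcont.tendsto ρ).mono_left (nhdsWithin_le_nhds (s := Set.Ioi ρ))
    have h2 := le_of_tendsto h1 (Filter.mem_of_superset (Ioo_mem_nhdsGT hρ1) fun s hs => step s hs.1 hs.2 N)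
    refine le_trans (le_of_eq ?_) h2
    congr 1
    refine Finset.sum_congr rfl fun j _ => ?_
    change _ = (((j:ℝ) + 1) ^ (-β)) ^ ρ
    rw [← Real.rpow_mul (by positivity), neg_mul, hβρ, Real.rpow_neg_one, one_div]
  have hdiv := Real.tendsto_sum_range_one_div_nat_succ_atTop
  obtain ⟨N, hN⟩ := (hdiv.eventually_gt_atTop (D / (κ * b / 2))).exists
  have := step2 N
  rw [div_lt_iff₀ (by positivity)] at hN
  linarith

end contra
end SV

namespace SV
universe u
section asym

theorem tail_mul {f : ℕ → ℝ} (hf0 : ∀ n, 0 ≤ f n) (hf : Antitone f) (hs : Summable f) :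
    Tendsto (fun n : ℕ => ((n:ℝ) + 1) * f n) atTop (𝓝 0) := by
  rw [Metric.tendsto_atTop']
  intro ε hε
  have h1 := hs.hasSum.tendsto_sum_nat
  obtain ⟨N, hN⟩ := (h1.eventually (lt_mem_nhds (show ∑' j, f j - ε / 2 < ∑' j, f j by linarith))).exists
  have h2 : Tendsto (fun n => (N:ℝ) * f n) atTop (𝓝 0) := by
    simpa using hs.tendsto_atTop_zero.const_mul (N:ℝ)
  obtain ⟨M, hM⟩ := eventually_atTop.1 (h2.eventually (gt_mem_nhds (show 0 < ε / 2 by linarith)))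
  refine ⟨max N M, fun n hn => ?_⟩
  have hnN : N ≤ n := (le_max_left _ _).trans hn.le
  have hnM : M ≤ n := (le_max_right _ _).trans hn.le
  have h3 : ∑ j ∈ Finset.Ico N (n + 1), f j ≤ ∑' j, f j - ∑ j ∈ Finset.range N, f j := by
    rw [Finset.sum_Ico_eq_sub _ (by omega)]
    have := hs.sum_le_tsum (Finset.range (n + 1)) fun j _ => hf0 j
    linarith
  have h4 : (((n + 1 - N : ℕ) : ℝ)) * f n ≤ ∑ j ∈ Finset.Ico N (n + 1), f j := by
    have := Finset.card_nsmul_le_sum (Finset.Ico N (n + 1)) f (f n) (fun j hj => hf (by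
      have := (Finset.mem_Ico.1 hj).2; omega))
    rwa [Nat.card_Ico, nsmul_eq_mul] at this
  rw [Nat.cast_sub (by omega)] at h4
  push_cast at h4
  rw [Real.dist_eq, sub_zero, abs_of_nonneg (mul_nonneg (by positivity) (hf0 n))]
  have := hM n hnM
  linarith

variable {H : Type u} [NormedAddCommGroup H] [InnerProductSpace ℂ H]

theorem T_small (T : H →L[ℂ] H) {α q : ℝ} (hα : 0 < α) (hq0 : 0 < q) (hqα : q ≤ 1 / α)
    (hT : Summable (fun n : ℕ => sNum T (n + 1) ^ q)) :
    (sNum T) =o[atTop] fun n : ℕ => (n:ℝ) ^ (-α) := by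
  have h1 := tail_mul (f := fun n : ℕ => sNum T (n + 1) ^ q)
    (fun n => Real.rpow_nonneg (sNum_nonneg _ _) _)
    (fun m n hmn => Real.rpow_le_rpow (sNum_nonneg _ _) (sNum_antitone T (by omega) (by omega)) hq0.le) hT
  have h2 : Tendsto (fun n : ℕ => (n:ℝ) * sNum T n ^ q) atTop (𝓝 0) := by
    rw [← tendsto_add_atTop_iff_nat 1]
    simpa using h1
  rw [Asymptotics.isLittleO_iff]
  intro c hc
  filter_upwards [h2.eventually (gt_mem_nhds (Real.rpow_pos_of_pos hc q)), eventually_ge_atTop 1] with n hn hn1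
  have hn1' : (1:ℝ) ≤ n := by exact_mod_cast hn1
  have hn0 : (0:ℝ) < n := by linarith
  rw [Real.norm_of_nonneg (sNum_nonneg _ _), Real.norm_of_nonneg (by positivity)]
  have h3 : sNum T n ^ q ≤ (c * (n:ℝ) ^ (-α)) ^ q := by
    rw [Real.mul_rpow hc.le (by positivity), ← Real.rpow_mul hn0.le]
    have h4 : sNum T n ^ q ≤ c ^ q * (n:ℝ) ^ (-1:ℝ) := by
      rw [Real.rpow_neg_one, ← div_eq_mul_inv, le_div_iff₀ hn0]; linarith
    refine h4.trans (mul_le_mul_of_nonneg_left ?_ (by positivity))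
    refine Real.rpow_le_rpow_of_exponent_le hn1' ?_
    rw [le_div_iff₀ hα] at hqα
    linarith
  exact (Real.rpow_le_rpow_iff (sNum_nonneg _ _) (by positivity) hq0).1 h3

theorem C_big (C : H →L[ℂ] H) {α a : ℝ} 
    (hCα : Tendsto (fun n : ℕ => (n : ℝ) ^ α * sNum C n) atTop (𝓝 a)) :
    (sNum C) =O[atTop] fun n : ℕ => (n:ℝ) ^ (-α) := by
  have h := (hCα.isBigO_one ℝ).mul (Asymptotics.isBigO_refl (fun n : ℕ => (n:ℝ) ^ (-α)) atTop)
  refine h.congr' ?_ ?_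
  · filter_upwards [eventually_ge_atTop 1] with n hn
    have hn0 : (0:ℝ) < n := by exact_mod_cast hn
    have : (n:ℝ) ^ α * (n:ℝ) ^ (-α) = 1 := by rw [← Real.rpow_add hn0]; simp
    linear_combination (sNum C n) * this
  · filter_upwards with n; simp

theorem C_low (C : H →L[ℂ] H) {α a : ℝ} (ha : 0 < a)
    (hCα : Tendsto (fun n : ℕ => (n : ℝ) ^ α * sNum C n) atTop (𝓝 a)) :
    ∀ᶠ n : ℕ in atTop, a / 2 * (n:ℝ) ^ (-α) ≤ sNum C n := by
  filter_upwards [hCα.eventually (lt_mem_nhds (show a / 2 < a by linarith)), eventually_ge_atTop 1] with n hn hn1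
  have hn0 : (0:ℝ) < n := by exact_mod_cast hn1
  rw [Real.rpow_neg hn0.le, ← div_eq_mul_inv, div_le_iff₀ (by positivity)]
  linarith

theorem neg_rpow_tendsto {α : ℝ} (hα : 0 < α) : Tendsto (fun n : ℕ => (n:ℝ) ^ (-α)) atTop (𝓝 0) :=
  (tendsto_rpow_neg_atTop hα).comp tendsto_natCast_atTop_atTop

variable [CompleteSpace H]

theorem case_ne (A C T : H →L[ℂ] H) (hA : A = C + T) (hCpos : C.IsPositive)
    (hno : ¬∃ μ : ℂ, μ ≠ 0 ∧ Module.End.HasEigenvalue (ContinuousLinearMap.adjoint A : H →ₗ[ℂ] H) μ)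
    {α a q : ℝ} (hα0 : 0 < α) (hα2 : α < 2) (hα1 : α ≠ 1) (ha0 : 0 < a)
    (hCα : Tendsto (fun n : ℕ => (n : ℝ) ^ α * sNum C n) atTop (𝓝 a))
    (hq0 : 0 < q) (hqα : q ≤ 1 / α)
    (hT : Summable (fun n : ℕ => sNum T (n + 1) ^ q)) : False := by
  have hCO := C_big C hCα
  have hTo := T_small T hα0 hq0 hqα hT
  have hC0 := hCO.trans_tendsto (neg_rpow_tendsto hα0)
  have hT0 := hTo.isBigO.trans_tendsto (neg_rpow_tendsto hα0)
  obtain ⟨k, hk, hk1, hk2⟩ : ∃ k : ℕ, 1 ≤ k ∧ 1 < k * α ∧ k * α < 2 := by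
    refine ⟨⌊1 / α⌋₊ + 1, by omega, ?_, ?_⟩
    · have := Nat.lt_floor_add_one (1 / α)
      rw [div_lt_iff₀ hα0] at this
      push_cast; exact this
    · rcases lt_or_gt_of_ne hα1 with h | h
      · have := Nat.floor_le (show 0 ≤ 1 / α by positivity)
        rw [le_div_iff₀ hα0] at this
        push_cast; linarith
      · have : ⌊1 / α⌋₊ = 0 := Nat.floor_eq_zero.2 (by rw [div_lt_one hα0]; exact h)
        rw [this]; push_cast; linarith
  set β := (k:ℝ) * α with hβ
  set ρ := 1 / β with hρ
  have hβ0 : 0 < β := by linarith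
  have hρ0 : 0 < ρ := by positivity
  have hρ1 : ρ < 1 := by rw [hρ, div_lt_one hβ0]; exact hk1
  have hρ2 : 1 / 2 < ρ := one_div_lt_one_div_of_lt hβ0 hk2
  have hβρ : β * ρ = 1 := by rw [hρ]; field_simp
  have hpi := Real.pi_pos
  have hθ0 : 0 < Real.pi / 2 * (1 - β / 2) := by
    have : 0 < 1 - β / 2 := by linarith
    positivity
  have hθ1 : Real.pi / 2 * (1 - β / 2) < Real.pi / 2 := by nlinarith
  have hρθ' : (Real.pi - Real.pi / 2 * (1 - β / 2)) * ρ = Real.pi / 2 * ρ + Real.pi / 4 := by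
    linear_combination Real.pi / 4 * hβρ
  have hρθ : Real.pi / 2 < (Real.pi - Real.pi / 2 * (1 - β / 2)) * ρ := by
    rw [hρθ']; nlinarith
  obtain ⟨τ, hτ0, hτ, hineq⟩ := lim_ineq A C T hA hCpos hC0 hT0 hno hα0 hCO hTo k hk hρ0 hβρ hθ0 hθ1 hρθ
  have hκ : 0 < -Real.cos ((Real.pi - Real.pi / 2 * (1 - β / 2)) * ρ) := by
    have := Real.cos_neg_of_pi_div_two_lt_of_lt hρθ (by rw [hρθ']; nlinarith)
    linarith
  have hδ0 : 0 < Real.sin (Real.pi / 2 * (1 - β / 2) / 2) :=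
    Real.sin_pos_of_pos_of_lt_pi (by linarith) (by linarith)
  refine contra (a := fun j => sNum C (j + 1) ^ k) (τ := fun j => τ (j + 1)) (b := min 1 ((a / 2) ^ k))
    hβ0 hρ0 hρ1 hβρ hκ (one_div_pos.2 hδ0) (by positivity) (min_le_left _ _)
    (fun i => pow_nonneg (sNum_nonneg _ _) _) (fun i => hτ0 _) ?_ ?_ hineq
  · filter_upwards [(tendsto_add_atTop_nat 1).eventually (C_low C ha0 hCα)] with n hn
    push_cast at hn
    have h1 := pow_le_pow_left₀ (by positivity) hn k
    refine le_trans ?_ h1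
    rw [mul_pow, ← Real.rpow_mul_natCast (by positivity)]
    have h2 : -α * (k:ℝ) = -β := by rw [hβ]; ring
    rw [h2]
    exact mul_le_mul_of_nonneg_right (min_le_right _ _) (by positivity)
  · intro ε hε
    have h1 := Asymptotics.isLittleO_iff.1 hτ hε
    filter_upwards [(tendsto_add_atTop_nat 1).eventually h1] with n hn
    rw [Real.norm_of_nonneg (hτ0 _), Real.norm_of_nonneg (by positivity)] at hn
    push_cast at hn
    exact hn

end asym
end SV

namespace SV
universe u
section one
open Module

theorem log_norm_lower {z : ℂ} (hz : ‖z‖ ≤ 1 / 2) : z.re - ‖z‖ ^ 2 ≤ Real.log ‖1 + z‖ := by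
  have h1 := Complex.norm_log_one_add_sub_self_le (z := z) (by linarith)
  have h2 := (abs_le.1 ((Complex.abs_re_le_norm _).trans h1)).1
  rw [Complex.sub_re, Complex.log_re] at h2
  have h3 : (1 - ‖z‖)⁻¹ ≤ 2 := by
    rw [inv_le_comm₀ (by linarith) two_pos]; linarith
  have h4 := mul_le_mul_of_nonneg_left h3 (sq_nonneg ‖z‖)
  linarith

/-- The defect function `c - log (1 + r c) / r`. -/
noncomputable def fr (r c : ℝ) : ℝ := c - Real.log (1 + r * c) / r

theorem fr_nonneg {r c : ℝ} (hr : 0 < r) (hc : 0 ≤ c) : 0 ≤ fr r c := by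
  unfold fr
  have : Real.log (1 + r * c) ≤ r * c := by
    have := Real.log_le_sub_one_of_pos (x := 1 + r * c) (by positivity); linarith
  rw [sub_nonneg, div_le_iff₀ hr]; linarith

theorem fr_mono {r c d : ℝ} (hr : 0 < r) (hc : 0 ≤ c) (hcd : c ≤ d) : fr r c ≤ fr r d := by
  unfold fr
  have h1 : (0:ℝ) < 1 + r * c := by positivity
  have h2 : (0:ℝ) < 1 + r * d := by have := hc.trans hcd; positivity
  have h3 : Real.log (1 + r * d) - Real.log (1 + r * c) ≤ r * (d - c) := by
    rw [← Real.log_div h2.ne' h1.ne']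
    refine (Real.log_le_sub_one_of_pos (div_pos h2 h1)).trans ?_
    rw [div_sub_one h1.ne', div_le_iff₀ h1]
    have : 0 ≤ r * (d - c) * (r * c) := by
      have : 0 ≤ d - c := by linarith
      positivity
    nlinarith
  have h4 : Real.log (1 + r * d) / r - Real.log (1 + r * c) / r ≤ d - c := by
    rw [← sub_div, div_le_iff₀ hr]; linarith
  linarith

theorem fr_tendsto {c : ℝ} (hc : 0 ≤ c) : Tendsto (fun r => fr r c) atTop (𝓝 c) := by
  have h : Tendsto (fun r : ℝ => Real.log (1 + r * c) / r) atTop (𝓝 0) := by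
    have hu : Tendsto (fun r : ℝ => 2 * √(1 + c) * (√r)⁻¹) atTop (𝓝 0) := by
      simpa using (Real.tendsto_sqrt_atTop.inv_tendsto_atTop).const_mul (2 * √(1 + c))
    refine tendsto_of_tendsto_of_tendsto_of_le_of_le' tendsto_const_nhds hu ?_ ?_
    · filter_upwards [eventually_ge_atTop 1] with r hr
      exact div_nonneg (Real.log_nonneg (by nlinarith)) (by linarith)
    · filter_upwards [eventually_ge_atTop 1] with r hr
      have hr0 : 0 < r := by linarith
      have h1 : (0:ℝ) < 1 + r * c := by positivity
      have h2 : Real.log (1 + r * c) ≤ 2 * √(1 + r * c) := by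
        have := Real.log_le_sub_one_of_pos (Real.sqrt_pos.2 h1)
        rw [Real.log_sqrt h1.le] at this
        linarith
      have h3 : √(1 + r * c) ≤ √(1 + c) * √r := by
        rw [← Real.sqrt_mul (by linarith)]
        exact Real.sqrt_le_sqrt (by nlinarith)
      rw [div_le_iff₀ hr0]
      have h4 : (√r)⁻¹ * r = √r := by
        rw [mul_comm, ← div_eq_mul_inv, Real.div_sqrt]
      rw [mul_assoc, h4]
      linarith
  unfold fr
  simpa using h.const_sub c

variable {V : Type*} [NormedAddCommGroup V] [InnerProductSpace ℂ V] [FiniteDimensional ℂ V]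

theorem det_sq (A : V →L[ℂ] V) {m : ℕ} (l : Fin m → ℂ)
    (h : ∀ w : ℂ, (1 + w • A).det = ∏ i, (1 + w * l i)) (w : ℂ) :
    (1 + w • A ^ 2).det = ∏ i, (1 + w * l i ^ 2) := by
  obtain ⟨z, hz⟩ : ∃ z : ℂ, z ^ 2 = -w := IsAlgClosed.exists_pow_nat_eq _ two_pos
  have e : 1 + w • A ^ 2 = (1 + z • A) * (1 + (-z) • A) := by
    have hw : w = -(z * z) := by rw [← sq, hz, neg_neg]
    rw [hw]
    simp only [add_mul, mul_add, one_mul, mul_one, smul_mul_smul_comm, sq]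
    module
  have e2 : ((1 + z • A) * (1 + (-z) • A)).det = (1 + z • A).det * (1 + (-z) • A).det := by
    unfold ContinuousLinearMap.det
    rw [← LinearMap.det_comp]; rfl
  rw [e, e2, h, h, ← Finset.prod_mul_distrib]
  refine Finset.prod_congr rfl fun i _ => ?_
  linear_combination (-(l i)^2) * hz

theorem fd_one (C T : V →L[ℂ] V) (hC : C.IsPositive) {η r : ℝ} (hη : 0 < η) (hr : 0 < r) (hrη : r * η ≤ 1 / 2)
    (hl : ∀ μ, Module.End.HasEigenvalue ((C + T : V →L[ℂ] V) : V →ₗ[ℂ] V) μ → ‖μ‖ ≤ η) :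
    ∑ j : Fin (finrank ℂ V), fr r (sNum C (j + 1)) ≤ 2 * ∑ j : Fin (finrank ℂ V), sNum T (j + 1) +
      r * ((η ^ 2) ^ (1 / 4 : ℝ) * (g (3 / 4) / L (3 / 4) *
        ∑ j : Fin (finrank ℂ V), sNum ((C + T) ^ 2) (j + 1) ^ (3 / 4 : ℝ))) := by
  obtain ⟨m, l, h1, h2, h3⟩ := exists_eig (C + T)
  obtain ⟨b, c, hc0, hc1, hc2⟩ := exists_pos_eig C hC
  have hlη : ∀ i, ‖l i‖ ≤ η := fun i => hl _ (h2 i)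
  have hsq : ∑ i, ‖l i‖ ^ 2 ≤ (η ^ 2) ^ (1 / 4 : ℝ) * (g (3 / 4) / L (3 / 4) *
        ∑ j : Fin (finrank ℂ V), sNum ((C + T) ^ 2) (j + 1) ^ (3 / 4 : ℝ)) := by
    have hw := weyl (fun i => l i ^ 2) (fun j : Fin (finrank ℂ V) => sNum ((C + T) ^ 2) (j + 1))
      (fun j => sNum_nonneg _ _) (fun z => by
        have := det_one_add_le ((C + T) ^ 2) z
        rwa [det_sq _ l h1, norm_prod] at this) (v := 3 / 4) (by norm_num) (by norm_num)
    refine le_trans ?_ (mul_le_mul_of_nonneg_left hw (by positivity))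
    rw [Finset.mul_sum]
    refine Finset.sum_le_sum fun i _ => ?_
    rw [norm_pow]
    have e : ‖l i‖ ^ 2 = (‖l i‖ ^ 2) ^ (1 / 4 : ℝ) * (‖l i‖ ^ 2) ^ (3 / 4 : ℝ) := by
      rw [← Real.rpow_add_of_nonneg (by positivity) (by norm_num) (by norm_num)]; norm_num
    conv_lhs => rw [e]
    refine mul_le_mul_of_nonneg_right ?_ (by positivity)
    exact Real.rpow_le_rpow (by positivity) (pow_le_pow_left₀ (norm_nonneg _) (hlη i) 2) (by norm_num)
  have hdet : ∏ i, ‖1 + (r : ℂ) * l i‖ ≤ (∏ i, (1 + r * c i)) * ∏ j : Fin (finrank ℂ V), (1 + r * sNum T (j + 1)) := by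
    have hd := det_ineq C T hC (r : ℂ) 1 one_pos ?_
    · rw [h1, norm_prod, det_diag (1 + (r : ℂ) • C) b (fun i => 1 + (r : ℂ) * (c i : ℂ)) ?_, norm_prod] at hd
      · refine hd.trans (le_of_eq ?_)
        congr 1
        · refine Finset.prod_congr rfl fun i _ => ?_
          have := hc0 i
          rw [← Complex.ofReal_mul, ← Complex.ofReal_one, ← Complex.ofReal_add, Complex.norm_real,
            Real.norm_of_nonneg (by positivity)]
        · rw [Complex.norm_real, Real.norm_of_nonneg hr.le, div_one]
      · intro i
        rw [add_apply, one_apply_eq_self, smul_apply, hc1 i]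
        module
    · intro y hy
      rw [← Complex.ofReal_mul, ← Complex.ofReal_one, ← Complex.ofReal_add, Complex.norm_real]
      have : (0:ℝ) ≤ r * y := by positivity
      rw [Real.norm_of_nonneg (by linarith)]
      linarith
  have hz : ∀ i, ‖(r : ℂ) * l i‖ ≤ 1 / 2 := by
    intro i
    rw [norm_mul, Complex.norm_real, Real.norm_of_nonneg hr.le]
    exact (mul_le_mul_of_nonneg_left (hlη i) hr.le).trans hrη
  have hpos : ∀ i, 0 < ‖1 + (r : ℂ) * l i‖ := by
    intro i
    have h5 := norm_sub_norm_le (1 : ℂ) (-((r : ℂ) * l i))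
    rw [norm_neg, norm_one, sub_neg_eq_add] at h5
    linarith [hz i]
  have hcp : ∀ i, 0 < 1 + r * c i := fun i => by have := hc0 i; positivity
  have htp : ∀ j : Fin (finrank ℂ V), 0 < 1 + r * sNum T (j + 1) := fun j => by
    have := sNum_nonneg T (j + 1); positivity
  have hlog := Real.log_le_log (Finset.prod_pos fun i _ => hpos i) hdet
  rw [Real.log_mul (Finset.prod_pos fun i _ => hcp i).ne' (Finset.prod_pos fun i _ => htp i).ne',
    Real.log_prod (fun i _ => (hpos i).ne'), Real.log_prod (fun i _ => (hcp i).ne'),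
    Real.log_prod (fun i _ => (htp i).ne')] at hlog
  have f1 : ∑ i, (r * (l i).re - r ^ 2 * ‖l i‖ ^ 2) ≤ ∑ i, Real.log ‖1 + (r : ℂ) * l i‖ := by
    refine Finset.sum_le_sum fun i _ => ?_
    have := log_norm_lower (hz i)
    rwa [Complex.re_ofReal_mul, norm_mul, Complex.norm_real, Real.norm_of_nonneg hr.le, mul_pow] at this
  have f2 : ∑ j : Fin (finrank ℂ V), Real.log (1 + r * sNum T (j + 1)) ≤ r * ∑ j : Fin (finrank ℂ V), sNum T (j + 1) := by
    rw [Finset.mul_sum]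
    refine Finset.sum_le_sum fun j _ => ?_
    have := Real.log_le_sub_one_of_pos (htp j)
    linarith
  have htr : (∑ i, (l i).re) = ∑ i, c i + (LinearMap.trace ℂ V (T : V →ₗ[ℂ] V)).re := by
    have hc : LinearMap.trace ℂ V (C : V →ₗ[ℂ] V) = ((∑ i, c i : ℝ) : ℂ) := by
      rw [LinearMap.trace_eq_sum_inner _ b]
      push_cast
      refine Finset.sum_congr rfl fun i _ => ?_
      rw [hc1 i, inner_smul_right, inner_self_eq_norm_sq_to_K, b.norm_eq_one]
      simp
    have h5 : LinearMap.trace ℂ V ((C + T : V →L[ℂ] V) : V →ₗ[ℂ] V) =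
        LinearMap.trace ℂ V (C : V →ₗ[ℂ] V) + LinearMap.trace ℂ V (T : V →ₗ[ℂ] V) := by
      rw [← map_add]; rfl
    rw [h3, hc] at h5
    have := congrArg Complex.re h5
    rwa [Complex.re_sum, Complex.add_re, Complex.ofReal_re] at this
  have hT := (abs_le.1 ((Complex.abs_re_le_norm _).trans (norm_trace_le T))).1
  rw [Finset.sum_sub_distrib, ← Finset.mul_sum, ← Finset.mul_sum, htr] at f1
  have f3 : ∑ i, fr r (c i) = ∑ i, c i - (∑ i, Real.log (1 + r * c i)) / r := by
    unfold fr
    rw [Finset.sum_sub_distrib, Finset.sum_div]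
  have f4 : ∑ j : Fin (finrank ℂ V), fr r (sNum C (j + 1)) ≤ ∑ i, fr r (c i) :=
    Finset.sum_le_sum fun i _ => fr_mono hr (sNum_nonneg _ _) (hc2 i)
  refine f4.trans ?_
  have f5 : ∑ i, fr r (c i) ≤ 2 * ∑ j : Fin (finrank ℂ V), sNum T (j + 1) + r * ∑ i, ‖l i‖ ^ 2 := by
    rw [f3, sub_le_iff_le_add, ← sub_le_iff_le_add', le_div_iff₀ hr]
    nlinarith
  exact f5.trans (add_le_add le_rfl (mul_le_mul_of_nonneg_left hsq hr.le))

end one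

section final
open Module
variable {H : Type u} [NormedAddCommGroup H] [InnerProductSpace ℂ H] [CompleteSpace H]

theorem case_one (A C T : H →L[ℂ] H) (hA : A = C + T) (hCpos : C.IsPositive)
    (hno : ¬∃ μ : ℂ, μ ≠ 0 ∧ Module.End.HasEigenvalue (ContinuousLinearMap.adjoint A : H →ₗ[ℂ] H) μ)
    {a q : ℝ} (ha0 : 0 < a)
    (hCα : Tendsto (fun n : ℕ => (n : ℝ) ^ (1:ℝ) * sNum C n) atTop (𝓝 a))
    (hq0 : 0 < q) (hqα : q ≤ 1 / 1)
    (hT : Summable (fun n : ℕ => sNum T (n + 1) ^ q)) : False := by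
  have hCO := C_big C hCα
  have hTo := T_small T one_pos hq0 hqα hT
  have hC0 := hCO.trans_tendsto (neg_rpow_tendsto one_pos)
  have hT0 := hTo.isBigO.trans_tendsto (neg_rpow_tendsto one_pos)
  have hT1 : Summable (fun n : ℕ => sNum T (n + 1)) := by
    refine Summable.of_norm_bounded_eventually_nat hT ?_
    filter_upwards [((tendsto_add_atTop_iff_nat 1).2 hT0).eventually (gt_mem_nhds one_pos)] with n hn
    rw [Real.norm_of_nonneg (sNum_nonneg _ _)]
    have := Real.rpow_le_rpow_of_exponent_ge' (sNum_nonneg T (n + 1)) hn.le hq0.le (by simpa using hqα)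
    rwa [Real.rpow_one] at this
  obtain ⟨B, τ, hB0, -, hB, -, hall⟩ := powers.{u} one_pos (sNum C) (sNum T) (sNum_nonneg C)
    (sNum_nonneg T) hCO hTo 2 (by norm_num)
  have hSB : Summable fun j : ℕ => B (j + 1) ^ (3 / 4 : ℝ) :=
    summable_of_O hB (by norm_num) (by norm_num)
  set M := g (3 / 4) / L (3 / 4) * ∑' j : ℕ, B (j + 1) ^ (3 / 4 : ℝ) with hM
  have hgL : 0 ≤ g (3 / 4) / L (3 / 4) :=
    (div_pos (g_pos (by norm_num) (by norm_num)) (L_pos (by norm_num) (by norm_num))).le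
  have main : ∀ (N : ℕ) (r η : ℝ), 0 < r → 0 < η → r * η ≤ 1 / 2 →
      ∑ j ∈ Finset.range N, fr r (max (sNum C (j + 1) - η) 0) ≤
        2 * ∑' j : ℕ, sNum T (j + 1) + r * ((η ^ 2) ^ (1 / 4 : ℝ) * M) := by
    intro N r η hr hη hrη
    obtain ⟨V, _, _, _, C', T', hC', h1, h2, h3, h4⟩ := compress A C T hA hCpos hC0 hT0 hno hη
    have hV := hall V C' T' h1 h2
    have key := fd_one C' T' hC' hη hr hrη (fun μ hμ => by
      have := h4 1 μ (by rwa [pow_one]); rwa [pow_one] at this)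
    refine le_trans ?_ (key.trans (add_le_add ?_ ?_))
    · refine le_sum_fin (F := fun j => fr r (sNum C' (j + 1))) (fun j => fr_nonneg hr (sNum_nonneg _ _)) ?_ ?_ N
      · intro j hj
        rw [sNum_eq_zero C' hj]; simp [fr]
      · intro j
        exact fr_mono hr (le_max_right _ _) (max_le (by linarith [h3 (j + 1) (by omega)]) (sNum_nonneg _ _))
    · refine mul_le_mul_of_nonneg_left ?_ two_pos.le
      exact sum_fin_le (f := fun j => sNum T' (j + 1)) (fun j => sNum_nonneg _ _) hT1
        (fun j => h2 (j + 1) (by omega)) _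
    · refine mul_le_mul_of_nonneg_left (mul_le_mul_of_nonneg_left (mul_le_mul_of_nonneg_left ?_ hgL) (by positivity)) hr.le
      refine sum_fin_le (f := fun j => sNum ((C' + T') ^ 2) (j + 1) ^ (3 / 4 : ℝ))
        (fun j => Real.rpow_nonneg (hB0 _) _) hSB (fun j => ?_) _
      exact Real.rpow_le_rpow (sNum_nonneg _ _) (hV (j + 1) (by omega)).1 (by norm_num)
  have step : ∀ (N : ℕ) (r : ℝ), 0 < r →
      ∑ j ∈ Finset.range N, fr r (sNum C (j + 1)) ≤ 2 * ∑' j : ℕ, sNum T (j + 1) := by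
    intro N r hr
    have lhs : Tendsto (fun η : ℝ => ∑ j ∈ Finset.range N, fr r (max (sNum C (j + 1) - η) 0))
        (𝓝[>] 0) (𝓝 (∑ j ∈ Finset.range N, fr r (sNum C (j + 1)))) := by
      have hcont : Continuous (fun η : ℝ => ∑ j ∈ Finset.range N, fr r (max (sNum C (j + 1) - η) 0)) := by
        refine continuous_finsetSum _ fun j _ => ?_
        unfold fr
        refine Continuous.sub (by fun_prop) (Continuous.div_const (Continuous.log (by fun_prop) fun x => ?_) _)
        positivity
      have := (hcont.tendsto 0).mono_left (nhdsWithin_le_nhds (s := Set.Ioi 0))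
      simpa [max_eq_left (sNum_nonneg C _)] using this
    have rhs : Tendsto (fun η : ℝ => 2 * ∑' j : ℕ, sNum T (j + 1) + r * ((η ^ 2) ^ (1 / 4 : ℝ) * M))
        (𝓝[>] 0) (𝓝 (2 * ∑' j : ℕ, sNum T (j + 1))) := by
      have hcont : Continuous (fun η : ℝ => 2 * ∑' j : ℕ, sNum T (j + 1) + r * ((η ^ 2) ^ (1 / 4 : ℝ) * M)) := by
        refine Continuous.add continuous_const (continuous_const.mul (Continuous.mul ?_ continuous_const))
        exact Continuous.rpow_const (by fun_prop) (fun _ => Or.inr (by norm_num))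
      have := (hcont.tendsto 0).mono_left (nhdsWithin_le_nhds (s := Set.Ioi 0))
      simpa using this
    refine le_of_tendsto_of_tendsto lhs rhs ?_
    filter_upwards [Ioo_mem_nhdsGT (show (0:ℝ) < 1 / 2 / r by positivity)] with η hη
    refine main N r η hr hη.1 ?_
    have := hη.2.le
    rw [le_div_iff₀ hr] at this
    linarith
  have step2 : ∀ N : ℕ, ∑ j ∈ Finset.range N, sNum C (j + 1) ≤ 2 * ∑' j : ℕ, sNum T (j + 1) := by
    intro N
    have := tendsto_finsetSum (Finset.range N) fun j _ => fr_tendsto (sNum_nonneg C (j + 1))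
    refine le_of_tendsto this ?_
    filter_upwards [eventually_gt_atTop 0] with r hr
    exact step N r hr
  have hsum := summable_of_sum_range_le (fun n => sNum_nonneg C (n + 1)) step2
  have hsum2 : Summable (fun n => sNum C n) := (summable_nat_add_iff (f := sNum C) 1).1 hsum
  refine Real.not_summable_one_div_natCast ?_
  have h1 : Summable fun n : ℕ => a / 2 * (1 / (n:ℝ)) := by
    refine Summable.of_norm_bounded_eventually_nat hsum2 ?_
    filter_upwards [C_low C ha0 hCα] with n hn
    rw [Real.norm_of_nonneg (by positivity)]
    rwa [Real.rpow_neg_one, ← one_div] at hn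
  exact (summable_mul_left_iff (by positivity)).1 h1

end final
end SV

/-- **Theorem 2.1.** If `A = C + T` with `C` a non-negative compact operator with
`n ^ 2 * s n (C) → ∞` and `n ^ α * s n (C) → a` for some `0 < α < 2`, `0 < a < ∞`, and
`T` a compact operator in the Schatten–von Neumann class `S_q` for some `0 < q ≤ 1/α`,
then the adjoint `A^*` cannot be Volterra, i.e. `A^*` has a nonzero eigenvalue. -/
theorem statement2 {H : Type*} [NormedAddCommGroup H] [InnerProductSpace ℂ H]
    [CompleteSpace H] (A C T : H →L[ℂ] H) (hA : A = C + T)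
    (hCcompact : IsCompactOperator (⇑C)) (hCpos : C.IsPositive)
    (hTcompact : IsCompactOperator (⇑T))
    (α a q : ℝ) (hα0 : 0 < α) (hα2 : α < 2) (ha0 : 0 < a)
    (hC2 : Tendsto (fun n : ℕ => (n : ℝ) ^ 2 * sNum C n) atTop atTop)
    (hCα : Tendsto (fun n : ℕ => (n : ℝ) ^ α * sNum C n) atTop (𝓝 a))
    (hq0 : 0 < q) (hqα : q ≤ 1 / α)
    (hT : Summable (fun n : ℕ => sNum T (n + 1) ^ q)) :
    ∃ μ : ℂ, μ ≠ 0 ∧ Module.End.HasEigenvalue (ContinuousLinearMap.adjoint A : H →ₗ[ℂ] H) μ := by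
  by_contra hno
  by_cases h1 : α = 1
  · subst h1
    exact SV.case_one A C T hA hCpos hno ha0 hCα hq0 hqα hT
  · exact SV.case_ne A C T hA hCpos hno hα0 hα2 h1 ha0 hCα hq0 hqα hT
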